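/- arXiv:math/0211442 — 2 statements merged into one kernel-verified Lean document; each statement's English description precedes it below -/
import Mathlib

section
/- Let n ≥ 1, p ≥ 1 and i ∈ {1,…,n}. For every column C of type B and height p, the word f̃_i(w(C)), if it is not the null symbol, is the reading of a column of type B and height p; likewise, the word ẽ_i(w(C)), if it is not the null symbol, is the reading of a column of type B and height p. -/
/-- The alphabet `𝔅_n = {1 ≺ ⋯ ≺ n ≺ 0 ≺ n̄ ≺ ⋯ ≺ 1̄}` with `2n+1` letters, encoded as
`Fin (2n+1)` with its natural order: the letter `j` (`1 ≤ j ≤ n`) is `j−1`, the letter `0`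
is `n`, and the barred letter `j̄` is `2n+1−j`. -/
abbrev BLetter (n : ℕ) := Fin (2 * n + 1)

/-- The label of the arrow of the type `B_n` crystal chain
`1 →¹ 2 →² ⋯ → n →ⁿ 0 →ⁿ n̄ →^{n−1} ⋯ →¹ 1̄`
leaving the letter encoded by the position `j`. -/
def bLabel (n j : ℕ) : ℕ := if j < n then j + 1 else 2 * n - j

/-- The Kashiwara operator `f̃_i` on a single letter of `𝔅_n`: it moves a letter one step
along the crystal chain when the arrow leaving it is labelled `i`, and gives the null
symbol (`none`) otherwise. -/
def fLetter (n i : ℕ) (x : BLetter n) : Option (BLetter n) :=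
  if h : (x : ℕ) < 2 * n ∧ bLabel n (x : ℕ) = i then
    some ⟨(x : ℕ) + 1, Nat.succ_lt_succ h.1⟩
  else none

/-- The Kashiwara operator `ẽ_i` on a single letter of `𝔅_n`: the reverse of `f̃_i`. -/
def eLetter (n i : ℕ) (x : BLetter n) : Option (BLetter n) :=
  if 1 ≤ (x : ℕ) ∧ bLabel n ((x : ℕ) - 1) = i then
    some ⟨(x : ℕ) - 1, lt_of_le_of_lt (Nat.sub_le _ _) x.isLt⟩
  else none

/-- Iteration of a partially defined operator (`none` is the null symbol, and any
expression involving the null symbol is null). -/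
def oiter {α : Type*} (g : α → Option α) : ℕ → α → Option α
  | 0, a => some a
  | m + 1, a => (g a).bind (oiter g m)

/-- `φ` of a partially defined operator at a point: the maximal number of times the
operator can be applied without producing the null symbol. -/
noncomputable def phiOf {α : Type*} (g : α → Option α) (a : α) : ℕ :=
  sSup {m | oiter g m a ≠ none}

/-- `ε_i` of a single letter: the maximal power of `ẽ_i` not giving the null symbol. -/
noncomputable def epsLetter (n i : ℕ) (x : BLetter n) : ℕ :=
  phiOf (eLetter n i) x

/-- One step of the recursive (tensor-rule) definition of `f̃_i` on words.  Words are
stored in *reversed* order, so that a word `w = u·v` (`v` its last letter) is the list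
`v :: uᵣ` with `uᵣ` the reversal of `u`; `prev` is `f̃_i` (in reversed encoding) on the
strictly shorter word `u`.  The rule: `f̃_i(u ⊗ v) = f̃_i(u) ⊗ v` if `φ_i(u) > ε_i(v)`,
and `u ⊗ f̃_i(v)` otherwise. -/
noncomputable def fStep (n i : ℕ) (prev : List (BLetter n) → Option (List (BLetter n))) :
    List (BLetter n) → Option (List (BLetter n))
  | [] => none
  | [x] => (fLetter n i x).map (fun y => [y])
  | v :: u =>
      if phiOf prev u > epsLetter n i v then (prev u).map (fun u' => v :: u')
      else (fLetter n i v).map (fun y => y :: u)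

/-- Fuel-indexed `f̃_i` on reversed words (the fuel bounds the length of the word). -/
noncomputable def fAux (n i : ℕ) : ℕ → List (BLetter n) → Option (List (BLetter n))
  | 0 => fun w => match w with
      | [x] => (fLetter n i x).map (fun y => [y])
      | _ => none
  | m + 1 => fStep n i (fAux n i m)

/-- One step of the recursive (tensor-rule) definition of `ẽ_i` on reversed words:
`ẽ_i(u ⊗ v) = u ⊗ ẽ_i(v)` if `φ_i(u) < ε_i(v)`, and `ẽ_i(u) ⊗ v` otherwise.
`prevF` and `prevE` are `f̃_i` and `ẽ_i` on the strictly shorter word `u`. -/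
noncomputable def eStep (n i : ℕ)
    (prevF prevE : List (BLetter n) → Option (List (BLetter n))) :
    List (BLetter n) → Option (List (BLetter n))
  | [] => none
  | [x] => (eLetter n i x).map (fun y => [y])
  | v :: u =>
      if phiOf prevF u < epsLetter n i v then (eLetter n i v).map (fun y => y :: u)
      else (prevE u).map (fun u' => v :: u')

/-- Fuel-indexed `ẽ_i` on reversed words. -/
noncomputable def eAux (n i : ℕ) : ℕ → List (BLetter n) → Option (List (BLetter n))
  | 0 => fun w => match w with
      | [x] => (eLetter n i x).map (fun y => [y])
      | _ => none
  | m + 1 => eStep n i (fAux n i m) (eAux n i m)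

/-- The Kashiwara operator `f̃_i` on words over `𝔅_n` (given as lists read left to
right), value `none` being the null symbol. -/
noncomputable def fWord (n i : ℕ) (w : List (BLetter n)) : Option (List (BLetter n)) :=
  (fAux n i w.length w.reverse).map List.reverse

/-- The Kashiwara operator `ẽ_i` on words over `𝔅_n`. -/
noncomputable def eWord (n i : ℕ) (w : List (BLetter n)) : Option (List (BLetter n)) :=
  (eAux n i w.length w.reverse).map List.reverse

/-- The reading of a column of type `B`: a weakly increasing word over `𝔅_n` in which
only the letter `0` (encoded as `n`) may occur more than once. -/
def IsColWordB (n : ℕ) (w : List (BLetter n)) : Prop :=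
  List.Chain' (fun a b => a < b ∨ (a = b ∧ (a : ℕ) = n)) w

/-- `HasDepth g N a` says that `g` can be applied to `a` exactly `N` times before producing
the null symbol. -/
def HasDepth {α : Type*} (g : α → Option α) : ℕ → α → Prop
  | 0, a => g a = none
  | N + 1, a => ∃ a', g a = some a' ∧ HasDepth g N a'

theorem HasDepth.oiter_ne_none_iff {α : Type*} {g : α → Option α} {N : ℕ} {a : α}
    (h : HasDepth g N a) (k : ℕ) : oiter g k a ≠ none ↔ k ≤ N := by
  induction N generalizing a k with
  | zero =>
    have h : g a = none := h
    cases k <;> simp [oiter, h]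
  | succ N ih =>
    obtain ⟨a', ha, h'⟩ := h
    cases k with
    | zero => simp [oiter]
    | succ k => simpa [oiter, ha] using ih h' k

theorem HasDepth.phiOf_eq {α : Type*} {g : α → Option α} {N : ℕ} {a : α}
    (h : HasDepth g N a) : phiOf g a = N := by
  have : {m | oiter g m a ≠ none} = Set.Iic N := Set.ext fun k => h.oiter_ne_none_iff k
  rw [phiOf, this, csSup_Iic]

theorem hasDepth_of_step {α : Type*} {g : α → Option α} (d : α → ℕ)
    (hzero : ∀ a, d a = 0 → g a = none)
    (hpos : ∀ a, 0 < d a → ∃ a', g a = some a' ∧ d a' + 1 = d a) (a : α) :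
    HasDepth g (d a) a := by
  induction hN : d a generalizing a with
  | zero => exact hzero a hN
  | succ N ih =>
    obtain ⟨a', ha, hd⟩ := hpos a (by omega)
    exact ⟨a', ha, ih a' (by omega)⟩

/-- The value of `φ_i` on the letter at position `j`. -/
def letterPhi (n i j : ℕ) : ℕ :=
  if i = n then if j + 1 = n then 2 else if j = n then 1 else 0
  else if j + 1 = i ∨ j + i = 2 * n then 1 else 0

/-- The value of `ε_i` on the letter at position `j`. -/
def letterEps (n i j : ℕ) : ℕ :=
  if i = n then if j = n + 1 then 2 else if j = n then 1 else 0
  else if j = i ∨ j + i = 2 * n + 1 then 1 else 0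

theorem letterEps_eq_letterPhi_of_zero_letter (n i : ℕ) :
    letterEps n i n = letterPhi n i n := by
  simp only [letterEps, letterPhi]
  grind

/-- The value of `φ_i` on a reversed word, computed by the tensor rule. -/
def wordPhi (n i : ℕ) : List (BLetter n) → ℕ
  | [] => 0
  | v :: u => letterPhi n i v + (wordPhi n i u - letterEps n i v)

/-- The relation between consecutive letters of a reversed column. -/
def ColDesc (n : ℕ) (a b : BLetter n) : Prop := b < a ∨ (b = a ∧ (b : ℕ) = n)

theorem isColWordB_reverse_iff {n : ℕ} {w : List (BLetter n)} :
    IsColWordB n w.reverse ↔ w.IsChain (ColDesc n) := by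
  have hmap : (w.reverse >>= fun a => pure (a : ℕ)) =
      w.reverse.map (fun a : BLetter n => (a : ℕ)) :=
    bind_pure_comp _ _
  unfold IsColWordB
  rw [hmap]
  refine (List.isChain_map _).trans (List.isChain_reverse.trans ?_)
  refine iff_of_eq (congrArg (List.IsChain · w) ?_)
  ext a b
  simp only [ColDesc, Fin.lt_def, Fin.ext_iff]

theorem fAux_nil (n i m : ℕ) : fAux n i m [] = none := by
  cases m <;> rfl

theorem eAux_nil (n i m : ℕ) : eAux n i m [] = none := by
  cases m <;> rfl

theorem eAux_singleton (n i m : ℕ) (x : BLetter n) :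
    eAux n i m [x] = (eLetter n i x).map (fun y => [y]) := by
  cases m <;> rfl

section Crystal

variable {n i : ℕ} (hi : 1 ≤ i) (hin : i ≤ n)
include hi hin

theorem fLetter_eq_some_iff {x y : BLetter n} :
    fLetter n i x = some y ↔
      (y : ℕ) = x + 1 ∧ ((x : ℕ) + 1 = i ∨ (x : ℕ) + i = 2 * n) := by
  have hx := x.isLt
  unfold fLetter
  split_ifs with h <;> simp only [bLabel] at h
  · simp only [Option.some.injEq, Fin.ext_iff]
    grind
  · simp only [false_iff]
    grind

theorem eLetter_eq_some_iff {x y : BLetter n} :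
    eLetter n i x = some y ↔
      (y : ℕ) + 1 = x ∧ ((y : ℕ) + 1 = i ∨ (y : ℕ) + i = 2 * n) := by
  have hx := x.isLt
  unfold eLetter
  split_ifs with h <;> simp only [bLabel] at h
  · simp only [Option.some.injEq, Fin.ext_iff]
    grind
  · simp only [false_iff]
    grind

theorem hasDepth_fLetter (x : BLetter n) :
    HasDepth (fLetter n i) (letterPhi n i x) x := by
  refine hasDepth_of_step (fun x : BLetter n => letterPhi n i x) (fun a ha => ?_)
    (fun a ha => ?_) x
  · rw [Option.eq_none_iff_forall_ne_some]
    intro y hy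
    rw [fLetter_eq_some_iff hi hin] at hy
    simp only [letterPhi] at ha
    grind
  · simp only [letterPhi] at ha
    have ha' : (a : ℕ) + 1 = i ∨ (a : ℕ) + i = 2 * n := by grind
    refine ⟨⟨a + 1, by omega⟩, (fLetter_eq_some_iff hi hin).2 ⟨rfl, ha'⟩, ?_⟩
    simp only [letterPhi]
    grind

theorem hasDepth_eLetter (x : BLetter n) :
    HasDepth (eLetter n i) (letterEps n i x) x := by
  refine hasDepth_of_step (fun x : BLetter n => letterEps n i x) (fun a ha => ?_)
    (fun a ha => ?_) x
  · rw [Option.eq_none_iff_forall_ne_some]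
    intro y hy
    rw [eLetter_eq_some_iff hi hin] at hy
    simp only [letterEps] at ha
    grind
  · have hlt := a.isLt
    simp only [letterEps] at ha
    have ha' : (a : ℕ) - 1 + 1 = a ∧ ((a : ℕ) - 1 + 1 = i ∨ (a : ℕ) - 1 + i = 2 * n) := by grind
    refine ⟨⟨a - 1, by omega⟩, (eLetter_eq_some_iff hi hin).2 ha', ?_⟩
    simp only [letterEps]
    grind

theorem epsLetter_eq (x : BLetter n) : epsLetter n i x = letterEps n i x :=
  (hasDepth_eLetter hi hin x).phiOf_eq

theorem letterEps_and_letterPhi_of_fLetter {x y : BLetter n} (h : fLetter n i x = some y) :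
    letterEps n i y = letterEps n i x + 1 ∧ letterPhi n i x = letterPhi n i y + 1 := by
  rw [fLetter_eq_some_iff hi hin] at h
  simp only [letterEps, letterPhi]
  grind

theorem eq_zero_letter_of_letterEps_lt {x y : BLetter n} (h : fLetter n i x = some y)
    (hlt : letterEps n i y < letterPhi n i x) : (y : ℕ) = n := by
  rw [fLetter_eq_some_iff hi hin] at h
  simp only [letterEps, letterPhi] at hlt
  grind

theorem eq_zero_letter_of_letterPhi_lt {x y : BLetter n} (h : eLetter n i y = some x)
    (hlt : letterPhi n i x < letterEps n i y) : (x : ℕ) = n := by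
  rw [eLetter_eq_some_iff hi hin] at h
  simp only [letterEps, letterPhi] at hlt
  grind

theorem fStep_cons {prev : List (BLetter n) → Option (List (BLetter n))}
    (hnil : prev [] = none) {M : ℕ} {u : List (BLetter n)} (hu : HasDepth prev M u)
    (v : BLetter n) :
    fStep n i prev (v :: u) =
      if letterEps n i v < M then (prev u).map (v :: ·) else (fLetter n i v).map (· :: u) := by
  cases u with
  | nil =>
    have hM : M = 0 := by
      cases M with
      | zero => rfl
      | succ M =>
        obtain ⟨a, ha, -⟩ := hu
        simp [hnil] at ha
    simp [fStep, hM]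
  | cons y u => simp [fStep, hu.phiOf_eq, epsLetter_eq hi hin]

theorem hasDepth_fStep_cons {prev : List (BLetter n) → Option (List (BLetter n))}
    (hnil : prev [] = none) {M : ℕ} {u : List (BLetter n)} (hu : HasDepth prev M u)
    (v : BLetter n) :
    HasDepth (fStep n i prev) (letterPhi n i v + (M - letterEps n i v)) (v :: u) := by
  induction hN : letterPhi n i v + (M - letterEps n i v) generalizing M u v with
  | zero =>
    have hv := hasDepth_fLetter hi hin v
    rw [show letterPhi n i v = 0 by omega] at hv
    have hv : fLetter n i v = none := hv
    change fStep n i prev (v :: u) = none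
    rw [fStep_cons hi hin hnil hu, if_neg (by omega), hv, Option.map_none]
  | succ N ih =>
    by_cases hlt : letterEps n i v < M
    · obtain ⟨M, rfl⟩ : ∃ M', M = M' + 1 := ⟨M - 1, by omega⟩
      have hstep := fStep_cons hi hin hnil hu v
      obtain ⟨u', hu', hd⟩ := hu
      exact ⟨v :: u', by simp [hstep, hlt, hu'], ih hd v (by omega)⟩
    · have hv := hasDepth_fLetter hi hin v
      obtain ⟨b, hb⟩ : ∃ b, letterPhi n i v = b + 1 := ⟨letterPhi n i v - 1, by omega⟩
      rw [hb] at hv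
      obtain ⟨v', hv', -⟩ := hv
      have := letterEps_and_letterPhi_of_fLetter hi hin hv'
      exact ⟨v' :: u, by simp [fStep_cons hi hin hnil hu v, hlt, hv'],
        ih hu v' (by omega)⟩

theorem hasDepth_fAux {m : ℕ} {w : List (BLetter n)} (hw : w.length ≤ m) :
    HasDepth (fAux n i m) (wordPhi n i w) w := by
  induction m generalizing w with
  | zero =>
    rw [List.length_eq_zero_iff.1 (by omega : w.length = 0)]
    exact fAux_nil n i 0
  | succ m ih =>
    cases w with
    | nil => exact fAux_nil n i (m + 1)
    | cons v u =>
      exact hasDepth_fStep_cons hi hin (fAux_nil n i m) (ih (by simpa using hw)) v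

theorem fAux_succ_cons {m : ℕ} {v : BLetter n} {u : List (BLetter n)} (hu : u.length ≤ m) :
    fAux n i (m + 1) (v :: u) =
      if letterEps n i v < wordPhi n i u then (fAux n i m u).map (v :: ·)
      else (fLetter n i v).map (· :: u) :=
  fStep_cons hi hin (fAux_nil n i m) (hasDepth_fAux hi hin hu) v

theorem eAux_succ_cons_cons {m : ℕ} {v y : BLetter n} {u : List (BLetter n)}
    (hu : (y :: u).length ≤ m) :
    eAux n i (m + 1) (v :: y :: u) =
      if wordPhi n i (y :: u) < letterEps n i v then (eLetter n i v).map (· :: y :: u)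
      else (eAux n i m (y :: u)).map (v :: ·) := by
  simp [eAux, eStep, (hasDepth_fAux hi hin hu).phiOf_eq, epsLetter_eq hi hin]

theorem exists_of_fAux_cons_eq_some {m : ℕ} {y : BLetter n} {u w' : List (BLetter n)}
    (hm : (y :: u).length ≤ m) (h : fAux n i m (y :: u) = some w') :
    ∃ y' u', w' = y' :: u' ∧
      (y' = y ∨ fLetter n i y = some y' ∧ wordPhi n i (y :: u) = letterPhi n i y) := by
  cases m with
  | zero => simp at hm
  | succ m =>
    rw [fAux_succ_cons hi hin (by simpa using hm)] at h
    split_ifs at h with hlt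
    · obtain ⟨u', -, rfl⟩ := Option.map_eq_some_iff.1 h
      exact ⟨y, u', rfl, Or.inl rfl⟩
    · obtain ⟨y', hy', rfl⟩ := Option.map_eq_some_iff.1 h
      refine ⟨y', u, rfl, Or.inr ⟨hy', ?_⟩⟩
      simp only [wordPhi]
      omega

theorem exists_of_eAux_cons_eq_some {m : ℕ} {y : BLetter n} {u w' : List (BLetter n)}
    (hm : (y :: u).length ≤ m) (h : eAux n i m (y :: u) = some w') :
    ∃ y' u', w' = y' :: u' ∧ (y' = y ∨ eLetter n i y = some y') := by
  cases m with
  | zero => simp at hm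
  | succ m =>
    cases u with
    | nil =>
      rw [eAux_singleton] at h
      obtain ⟨y', hy', rfl⟩ := Option.map_eq_some_iff.1 h
      exact ⟨y', [], rfl, Or.inr hy'⟩
    | cons z u =>
      rw [eAux_succ_cons_cons hi hin (by simpa using hm)] at h
      split_ifs at h with hlt
      · obtain ⟨y', hy', rfl⟩ := Option.map_eq_some_iff.1 h
        exact ⟨y', z :: u, rfl, Or.inr hy'⟩
      · obtain ⟨u', -, rfl⟩ := Option.map_eq_some_iff.1 h
        exact ⟨y, u', rfl, Or.inl rfl⟩

theorem colDesc_of_fLetter_left {v v' y : BLetter n} (hvy : ColDesc n v y)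
    (hv' : fLetter n i v = some v') : ColDesc n v' y := by
  rw [fLetter_eq_some_iff hi hin] at hv'
  simp only [ColDesc, Fin.lt_def, Fin.ext_iff] at *
  omega

theorem colDesc_of_fLetter_right {v y y' : BLetter n} (hvy : ColDesc n v y)
    (hy' : fLetter n i y = some y') (hlt : letterEps n i v < letterPhi n i y) :
    ColDesc n v y' := by
  have hzero : y' = v → (v : ℕ) = n := by
    rintro rfl
    exact eq_zero_letter_of_letterEps_lt hi hin hy' hlt
  have hne : ¬((y : ℕ) = v ∧ (v : ℕ) = n) := by
    rintro ⟨h₁, h₂⟩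
    rw [h₁, h₂, letterEps_eq_letterPhi_of_zero_letter] at hlt
    exact lt_irrefl _ hlt
  rw [fLetter_eq_some_iff hi hin] at hy'
  simp only [ColDesc, Fin.lt_def, Fin.ext_iff] at *
  omega

theorem colDesc_of_eLetter_left {v v' y : BLetter n} (hvy : ColDesc n v y)
    (hv' : eLetter n i v = some v') (hlt : letterPhi n i y < letterEps n i v) :
    ColDesc n v' y := by
  have hzero : v' = y → (y : ℕ) = n := by
    rintro rfl
    exact eq_zero_letter_of_letterPhi_lt hi hin hv' hlt
  have hne : ¬((y : ℕ) = v ∧ (v : ℕ) = n) := by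
    rintro ⟨h₁, h₂⟩
    rw [h₁, h₂, letterEps_eq_letterPhi_of_zero_letter] at hlt
    exact lt_irrefl _ hlt
  rw [eLetter_eq_some_iff hi hin] at hv'
  simp only [ColDesc, Fin.lt_def, Fin.ext_iff] at *
  omega

theorem colDesc_of_eLetter_right {v y y' : BLetter n} (hvy : ColDesc n v y)
    (hy' : eLetter n i y = some y') : ColDesc n v y' := by
  rw [eLetter_eq_some_iff hi hin] at hy'
  simp only [ColDesc, Fin.lt_def, Fin.ext_iff] at *
  omega

theorem isChain_of_fAux_eq_some {m : ℕ} {w w' : List (BLetter n)} (hm : w.length ≤ m)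
    (hw : w.IsChain (ColDesc n)) (h : fAux n i m w = some w') :
    w'.IsChain (ColDesc n) ∧ w'.length = w.length := by
  induction w generalizing m w' with
  | nil => simp [fAux_nil] at h
  | cons v u ih =>
    obtain ⟨m, rfl⟩ : ∃ k, m = k + 1 := ⟨m - 1, by simp at hm; omega⟩
    have hm : u.length ≤ m := by simpa using hm
    rw [fAux_succ_cons hi hin hm] at h
    split_ifs at h with hlt
    · obtain ⟨u', hu', rfl⟩ := Option.map_eq_some_iff.1 h
      obtain ⟨hc, hl⟩ := ih hm hw.of_cons hu'
      refine ⟨?_, by simp [hl]⟩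
      cases u with
      | nil => simp [fAux_nil] at hu'
      | cons y u =>
        obtain ⟨hvy, -⟩ := List.isChain_cons_cons.1 hw
        obtain ⟨y', u', rfl, rfl | ⟨hy', hphi⟩⟩ := exists_of_fAux_cons_eq_some hi hin hm hu'
        · exact List.isChain_cons_cons.2 ⟨hvy, hc⟩
        · exact List.isChain_cons_cons.2
            ⟨colDesc_of_fLetter_right hi hin hvy hy' (hphi ▸ hlt), hc⟩
    · obtain ⟨v', hv', rfl⟩ := Option.map_eq_some_iff.1 h
      refine ⟨?_, rfl⟩
      cases u with
      | nil => exact List.isChain_singleton _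
      | cons y u =>
        obtain ⟨hvy, hu⟩ := List.isChain_cons_cons.1 hw
        exact List.isChain_cons_cons.2 ⟨colDesc_of_fLetter_left hi hin hvy hv', hu⟩

theorem isChain_of_eAux_eq_some {m : ℕ} {w w' : List (BLetter n)} (hm : w.length ≤ m)
    (hw : w.IsChain (ColDesc n)) (h : eAux n i m w = some w') :
    w'.IsChain (ColDesc n) ∧ w'.length = w.length := by
  induction w generalizing m w' with
  | nil => simp [eAux_nil] at h
  | cons v u ih =>
    obtain ⟨m, rfl⟩ : ∃ k, m = k + 1 := ⟨m - 1, by simp at hm; omega⟩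
    have hm : u.length ≤ m := by simpa using hm
    cases u with
    | nil =>
      rw [eAux_singleton] at h
      obtain ⟨v', -, rfl⟩ := Option.map_eq_some_iff.1 h
      exact ⟨List.isChain_singleton _, rfl⟩
    | cons y u =>
      obtain ⟨hvy, hu⟩ := List.isChain_cons_cons.1 hw
      rw [eAux_succ_cons_cons hi hin hm] at h
      split_ifs at h with hlt
      · obtain ⟨v', hv', rfl⟩ := Option.map_eq_some_iff.1 h
        have hle : letterPhi n i y ≤ wordPhi n i (y :: u) := Nat.le_add_right _ _
        exact ⟨List.isChain_cons_cons.2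
          ⟨colDesc_of_eLetter_left hi hin hvy hv' (hle.trans_lt hlt), hu⟩, rfl⟩
      · obtain ⟨u', hu', rfl⟩ := Option.map_eq_some_iff.1 h
        obtain ⟨hc, hl⟩ := ih hm hu hu'
        refine ⟨?_, by simp [hl]⟩
        obtain ⟨y', u', rfl, rfl | hy'⟩ := exists_of_eAux_cons_eq_some hi hin hm hu'
        · exact List.isChain_cons_cons.2 ⟨hvy, hc⟩
        · exact List.isChain_cons_cons.2 ⟨colDesc_of_eLetter_right hi hin hvy hy', hc⟩

end Crystal

/-- For `n ≥ 1`, `p ≥ 1` and `1 ≤ i ≤ n`, if `w` is the reading of a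
column of type `B` and height `p`, then `f̃_i(w)`, if not null, is again the reading of a
column of type `B` and height `p`, and likewise for `ẽ_i(w)`. -/
theorem kashiwara_preserves_columnsB (n p i : ℕ) (hn : 1 ≤ n) (hp : 1 ≤ p)
    (hi : 1 ≤ i) (hin : i ≤ n) (w : List (BLetter n))
    (hw : IsColWordB n w) (hlen : w.length = p) :
    (∀ w', fWord n i w = some w' → IsColWordB n w' ∧ w'.length = p) ∧
    (∀ w', eWord n i w = some w' → IsColWordB n w' ∧ w'.length = p) := by
  have hw' : w.reverse.IsChain (ColDesc n) := by
    rwa [← isColWordB_reverse_iff, List.reverse_reverse]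
  have hm : w.reverse.length ≤ w.length := by simp
  refine ⟨fun w' h => ?_, fun w' h => ?_⟩
  · obtain ⟨r, hr, rfl⟩ := Option.map_eq_some_iff.1 h
    obtain ⟨hc, hl⟩ := isChain_of_fAux_eq_some hi hin hm hw' hr
    exact ⟨isColWordB_reverse_iff.2 hc, by simpa [hlen] using hl⟩
  · obtain ⟨r, hr, rfl⟩ := Option.map_eq_some_iff.1 h
    obtain ⟨hc, hl⟩ := isChain_of_eAux_eq_some hi hin hm hw' hr
    exact ⟨isColWordB_reverse_iff.2 hc, by simpa [hlen] using hl⟩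
end

section
/- Let n ≥ 1, let λ = Σ_{p=1}^{n} μ_p ω_p with μ_p ∈ ℕ, and let T = C₁⋯C_s be an orthogonal tableau of type B and shape Y(λ) with T ≠ T_λ. Let C_k be the rightmost column of T whose reading is not a highest weight vertex (i.e. ẽ_i(w(C_k)) ≠ 0 for some i ∈ {1,…,n}); let z be the leftmost movable letter of w(C_k) and let i₁ be the unique index i with ẽ_{i}(z) ≠ 0. Define l as follows: if k = 1, set l = 1; if k > 1 and (f_{i₁} does not kill C_k, or ẽ_{i₁}(w(C_{k−1})) = 0), set l = k; otherwise let l be the smallest integer l < k such that (i) f_{i₁} kills C_j for j = l+1,…,k, and (ii) ẽ_{i₁}(w(C_j)) ≠ 0 for j = l,…,k. Set ε_{i₁,j} = ε_{i₁}(w(C_j)) for j = l,…,k, and let T₁ be the tabloid obtained from T by replacing each column C_j, j = l,…,k, by the column whose reading is ẽ_{i₁}^{ε_{i₁,j}}(w(C_j)). Then T₁ is again an orthogonal tableau of type B and shape Y(λ). -/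
/-- The letter of `𝔅_n` encoded by the position `m` (taken mod `2n+1`). -/
def ltr (n m : ℕ) : BLetter n := ⟨m % (2 * n + 1), Nat.mod_lt _ (by omega)⟩

/-- `ε_i` of a word: the maximal power of `ẽ_i` not giving the null symbol. -/
noncomputable def epsW (n i : ℕ) (w : List (BLetter n)) : ℕ :=
  phiOf (eWord n i) w

/-- The words of `B(λ)`: the nonnull words of the form
`f̃_{j₁}^{a₁}⋯f̃_{j_r}^{a_r}(w₀)` with `j₁,…,j_r ∈ {1,…,n}`, together with `w₀`. -/
inductive Reach (n : ℕ) (w₀ : List (BLetter n)) : List (BLetter n) → Prop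
  | base : Reach n w₀ w₀
  | step (i : ℕ) (hi1 : 1 ≤ i) (hin : i ≤ n) (w w' : List (BLetter n)) :
      Reach n w₀ w → fWord n i w = some w' → Reach n w₀ w'

/-- The list of column heights of the Young diagram `Y(λ)` of
`λ = ∑_{p=1}^{n} μ_p ω_p`: for `p = n` down to `1`, `μ_p` columns of height `p`,
listed from left to right in weakly decreasing order. -/
def shapeList (n : ℕ) (μ : ℕ → ℕ) : List ℕ :=
  (List.range n).reverse.flatMap (fun j => List.replicate (μ (j + 1)) (j + 1))

/-- The tabloid with columns `C 1, C 2, …, C s`, listed from left to right. -/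
def tabOf (n : ℕ) (s : ℕ) (C : ℕ → List (BLetter n)) : List (List (BLetter n)) :=
  (List.range s).map (fun j => C (j + 1))

/-- A tabloid of shape `Y(λ)`: an arbitrary filling of the diagram, i.e. a list of
columns (each a list of letters of `𝔅_n` read from top to bottom) whose heights are
those prescribed by the shape. -/
def IsTabloid (n : ℕ) (μ : ℕ → ℕ) (T : List (List (BLetter n))) : Prop :=
  T.map List.length = shapeList n μ

/-- The reading `w(τ) = w(C_s)⋯w(C₁)` of a tabloid `τ = C₁C₂⋯C_s`. -/
def reading (n : ℕ) (T : List (List (BLetter n))) : List (BLetter n) :=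
  T.reverse.flatten

/-- The tableau `T_λ`, whose `k`-th row is entirely filled with the letter `k`
(so each column of height `h` is filled with `1, 2, …, h` from top to bottom). -/
def Tlam (n : ℕ) (μ : ℕ → ℕ) : List (List (BLetter n)) :=
  (shapeList n μ).map (fun h => (List.range h).map (fun r => ltr n r))

/-- An orthogonal tableau of type `B` and shape `Y(λ)`: a tabloid whose reading lies
in `B(λ)`, the set of nonnull words obtained from `w(T_λ)` by applying Kashiwara
operators `f̃_i`. -/
def IsOrthTab (n : ℕ) (μ : ℕ → ℕ) (T : List (List (BLetter n))) : Prop :=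
  IsTabloid n μ T ∧ Reach n (reading n (Tlam n μ)) (reading n T)

/-- The subword `w_i(C)` of a column word, formed by the letters belonging to
`{i, i+1, \overline{i+1}, ī}` if `i < n`, and to `{n, 0, n̄}` if `i = n` (in the encoding:
positions `{i−1, i, 2n−i, 2n+1−i}`, resp. `{n−1, n, n+1}`). -/
def wSub (n i : ℕ) (c : List (BLetter n)) : List (BLetter n) :=
  if i < n then
    c.filter (fun x =>
      decide ((x : ℕ) + 1 = i ∨ (x : ℕ) = i ∨ (x : ℕ) = 2 * n - i ∨ (x : ℕ) = 2 * n + 1 - i))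
  else
    c.filter (fun x => decide ((x : ℕ) + 1 = n ∨ (x : ℕ) = n ∨ (x : ℕ) = n + 1))

/-- `f_i` does *not* kill the column `C` (i.e. `f_i v_C ≠ 0` in `W(ω_p^B)`):
either `f̃_i(w(C)) ≠ 0`, or (for `i < n`) `w_i(C) = i ī`, or (for `i = n`)
`w_i(C) = n 0^r n̄` for some `r ≥ 0`. -/
def NotKills (n i : ℕ) (c : List (BLetter n)) : Prop :=
  fWord n i c ≠ none ∨
  (i < n ∧ wSub n i c = [ltr n (i - 1), ltr n (2 * n + 1 - i)]) ∨
  (i = n ∧ ∃ r : ℕ, wSub n i c = ltr n (n - 1) :: (List.replicate r (ltr n n) ++ [ltr n (n + 1)]))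

/-- A letter `z` of the column word `c` is movable if for some `i` one has
`ẽ_i(z) ≠ 0` and `ẽ_i(z)` is not a letter of `c`. -/
def Movable (n : ℕ) (c : List (BLetter n)) (z : BLetter n) : Prop :=
  z ∈ c ∧ ∃ (i : ℕ) (y : BLetter n), eLetter n i z = some y ∧ y ∉ c

namespace BCrystal

/-! ### Letters -/

/-- Closed form of `ε_i` on a letter, for `1 ≤ i ≤ n`. -/
def epsL (n i : ℕ) (x : BLetter n) : ℕ :=
  if i < n then (if (x : ℕ) = i ∨ (x : ℕ) = 2 * n + 1 - i then 1 else 0)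
  else (if (x : ℕ) = n then 1 else if (x : ℕ) = n + 1 then 2 else 0)

/-- Closed form of `φ_i` on a letter, for `1 ≤ i ≤ n`. -/
def phiL (n i : ℕ) (x : BLetter n) : ℕ :=
  if i < n then (if (x : ℕ) + 1 = i ∨ (x : ℕ) = 2 * n - i then 1 else 0)
  else (if (x : ℕ) = n then 1 else if (x : ℕ) + 1 = n then 2 else 0)

section Letters

variable {n i : ℕ} (hi : 1 ≤ i) (hin : i ≤ n)
include hi hin

theorem fLetter_eq_none_iff (x : BLetter n) : fLetter n i x = none ↔ phiL n i x = 0 := by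
  have := x.isLt
  unfold fLetter phiL bLabel
  split_ifs <;> simp <;> omega

theorem eLetter_eq_none_iff (x : BLetter n) : eLetter n i x = none ↔ epsL n i x = 0 := by
  have := x.isLt
  unfold eLetter epsL bLabel
  split_ifs <;> simp <;> omega

omit hi in
theorem fLetter_spec {x y : BLetter n} (h : fLetter n i x = some y) :
    phiL n i x = phiL n i y + 1 ∧ epsL n i y = epsL n i x + 1 := by
  have := x.isLt
  unfold fLetter at h
  split_ifs at h with h1
  obtain rfl := Option.some.inj h
  unfold bLabel at h1
  unfold epsL phiL
  simp only
  split_ifs at h1 ⊢ <;> omega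

omit hi hin in
theorem eLetter_eq_some_iff {x y : BLetter n} :
    eLetter n i x = some y ↔ fLetter n i y = some x := by
  have := x.isLt
  have := y.isLt
  unfold fLetter eLetter
  split_ifs with h1 h2 h2
  · simp only [Option.some.injEq, Fin.ext_iff]
    omega
  · simp only [Option.some.injEq, Fin.ext_iff, iff_false]
    intro h
    rw [← h] at h2
    omega
  · simp only [Option.some.injEq, Fin.ext_iff, false_iff]
    intro h
    rw [← h] at h1
    simp only [Nat.add_sub_cancel] at h1
    omega
  · simp

end Letters

/-! ### Iterating partial operators -/

theorem oiter_ne_none_iff {α : Type*} {g : α → Option α} {φ : α → ℕ} {P : α → Prop}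
    (h0 : ∀ a, P a → (g a = none ↔ φ a = 0))
    (h1 : ∀ a b, P a → g a = some b → P b ∧ φ a = φ b + 1) (m : ℕ) (a : α) (ha : P a) :
    oiter g m a ≠ none ↔ m ≤ φ a := by
  induction m generalizing a with
  | zero => simp [oiter]
  | succ m ih =>
    rcases hg : g a with _ | b
    · have := (h0 a ha).1 hg
      simp [oiter, hg, this]
    · obtain ⟨hb, hab⟩ := h1 a b ha hg
      simp only [oiter, hg, Option.bind_some]
      rw [ih b hb]
      omega

theorem phiOf_eq {α : Type*} {g : α → Option α} {φ : α → ℕ} {P : α → Prop}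
    (h0 : ∀ a, P a → (g a = none ↔ φ a = 0))
    (h1 : ∀ a b, P a → g a = some b → P b ∧ φ a = φ b + 1) (a : α) (ha : P a) :
    phiOf g a = φ a := by
  have : {m | oiter g m a ≠ none} = Set.Iic (φ a) := by
    ext m
    exact oiter_ne_none_iff h0 h1 m a ha
  rw [phiOf, this]
  exact csSup_Iic

theorem epsLetter_eq {n i : ℕ} (hi : 1 ≤ i) (hin : i ≤ n) (x : BLetter n) :
    epsLetter n i x = epsL n i x :=
  phiOf_eq (P := fun _ => True) (fun a _ => eLetter_eq_none_iff hi hin a)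
    (fun _ _ _ h => ⟨trivial, (fLetter_spec hin (eLetter_eq_some_iff.1 h)).2⟩) x trivial

/-! ### Words in reversed order -/

/-- `φ_i` of a reversed word, computed by the signature rule. -/
def phiR (n i : ℕ) : List (BLetter n) → ℕ
  | [] => 0
  | v :: u => phiL n i v + (phiR n i u - epsL n i v)

/-- `ε_i` of a reversed word, computed by the signature rule. -/
def epsR (n i : ℕ) : List (BLetter n) → ℕ
  | [] => 0
  | v :: u => epsR n i u + (epsL n i v - phiR n i u)

/-- `f̃_i` on reversed words, by structural recursion. -/
def fR (n i : ℕ) : List (BLetter n) → Option (List (BLetter n))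
  | [] => none
  | v :: u => if phiR n i u > epsL n i v then (fR n i u).map (fun u' => v :: u')
      else (fLetter n i v).map (fun y => y :: u)

/-- `ẽ_i` on reversed words, by structural recursion. -/
def eR (n i : ℕ) : List (BLetter n) → Option (List (BLetter n))
  | [] => none
  | v :: u => if phiR n i u < epsL n i v then (eLetter n i v).map (fun y => y :: u)
      else (eR n i u).map (fun u' => v :: u')

section Reversed

variable {n i : ℕ} (hi : 1 ≤ i) (hin : i ≤ n)
include hi hin

theorem fR_eq_none_iff (w : List (BLetter n)) : fR n i w = none ↔ phiR n i w = 0 := by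
  induction w with
  | nil => simp [fR, phiR]
  | cons v u ih =>
    have := fLetter_eq_none_iff hi hin v
    simp only [fR, phiR]
    split_ifs with h <;> simp only [Option.map_eq_none_iff, ih, this] <;> omega

theorem eR_eq_none_iff (w : List (BLetter n)) : eR n i w = none ↔ epsR n i w = 0 := by
  induction w with
  | nil => simp [eR, epsR]
  | cons v u ih =>
    have := eLetter_eq_none_iff hi hin v
    simp only [eR, epsR]
    split_ifs with h <;> simp only [Option.map_eq_none_iff, ih, this] <;> omega

omit hi in
theorem fR_spec {w w' : List (BLetter n)} (h : fR n i w = some w') :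
    w'.length = w.length ∧ phiR n i w = phiR n i w' + 1 ∧
      epsR n i w' = epsR n i w + 1 := by
  induction w generalizing w' with
  | nil => simp [fR] at h
  | cons v u ih =>
    simp only [fR] at h
    split_ifs at h with h1 <;> obtain ⟨y, hy, rfl⟩ := Option.map_eq_some_iff.1 h
    · have := ih hy
      simp only [List.length_cons, phiR, epsR]
      omega
    · have := fLetter_spec hin hy
      simp only [List.length_cons, phiR, epsR]
      refine ⟨trivial, ?_, ?_⟩ <;> omega

omit hi in
theorem eR_eq_some_iff {w w' : List (BLetter n)} : eR n i w = some w' ↔ fR n i w' = some w := by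
  constructor
  · intro h
    induction w generalizing w' with
    | nil => simp [eR] at h
    | cons v u ih =>
      simp only [eR] at h
      split_ifs at h with h1 <;> obtain ⟨y, hy, rfl⟩ := Option.map_eq_some_iff.1 h
      · have hy' := eLetter_eq_some_iff.1 hy
        have := fLetter_spec hin hy'
        simp only [fR]
        rw [if_neg (by omega), hy']
        rfl
      · have hy' := ih hy
        have := fR_spec hin hy'
        simp only [fR]
        rw [if_pos (by omega), hy']
        rfl
  · intro h
    induction w' generalizing w with
    | nil => simp [fR] at h
    | cons v u ih =>
      simp only [fR] at h
      split_ifs at h with h1 <;> obtain ⟨y, hy, rfl⟩ := Option.map_eq_some_iff.1 h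
      · have hy' := ih hy
        have := fR_spec hin hy
        simp only [eR]
        rw [if_neg (by omega), hy']
        rfl
      · have hy' := eLetter_eq_some_iff.2 hy
        have := fLetter_spec hin hy
        simp only [eR]
        rw [if_pos (by omega), hy']
        rfl

theorem fAux_eq (m : ℕ) (w : List (BLetter n)) (hw : w.length ≤ m + 1) :
    fAux n i m w = fR n i w := by
  induction m generalizing w with
  | zero =>
    match w, hw with
    | [], _ => rfl
    | [x], _ => simp [fAux, fR, phiR]
  | succ m ih =>
    match w, hw with
    | [], _ => rfl
    | [x], _ => simp [fAux, fStep, fR, phiR]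
    | v :: x :: u, hw =>
      have hlen : (x :: u).length ≤ m + 1 := by simpa using hw
      have hphi : phiOf (fAux n i m) (x :: u) = phiR n i (x :: u) := by
        refine phiOf_eq (P := fun w => w.length ≤ m + 1) ?_ ?_ _ hlen
        · intro a ha
          rw [ih a ha, fR_eq_none_iff hi hin]
        · intro a b ha hab
          rw [ih a ha] at hab
          have := fR_spec hin hab
          exact ⟨this.1.trans_le ha, this.2.1⟩
      have hstep : fAux n i (m + 1) (v :: x :: u) =
          if phiOf (fAux n i m) (x :: u) > epsLetter n i v then
            (fAux n i m (x :: u)).map (fun u' => v :: u')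
          else (fLetter n i v).map (fun y => y :: x :: u) := rfl
      have hfR : fR n i (v :: x :: u) = if phiR n i (x :: u) > epsL n i v then
            (fR n i (x :: u)).map (fun u' => v :: u')
          else (fLetter n i v).map (fun y => y :: x :: u) := rfl
      rw [hstep, hfR, hphi, epsLetter_eq hi hin, ih _ hlen]

theorem eR_singleton (x : BLetter n) :
    eR n i [x] = (eLetter n i x).map (fun y => [y]) := by
  have h0 := eLetter_eq_none_iff hi hin x
  have h1 : phiR n i [] = 0 := rfl
  unfold eR
  split_ifs with h
  · rfl
  · rw [h0.2 (by omega)]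
    rfl

theorem eAux_eq (m : ℕ) (w : List (BLetter n)) (hw : w.length ≤ m + 1) :
    eAux n i m w = eR n i w := by
  induction m generalizing w with
  | zero =>
    match w, hw with
    | [], _ => rfl
    | [x], _ =>
      exact (eR_singleton hi hin x).symm
  | succ m ih =>
    match w, hw with
    | [], _ => rfl
    | [x], _ =>
      exact (eR_singleton hi hin x).symm
    | v :: x :: u, hw =>
      have hlen : (x :: u).length ≤ m + 1 := by simpa using hw
      have hphi : phiOf (fAux n i m) (x :: u) = phiR n i (x :: u) := by
        refine phiOf_eq (P := fun w => w.length ≤ m + 1) ?_ ?_ _ hlen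
        · intro a ha
          rw [fAux_eq hi hin m a ha, fR_eq_none_iff hi hin]
        · intro a b ha hab
          rw [fAux_eq hi hin m a ha] at hab
          have := fR_spec hin hab
          exact ⟨this.1.trans_le ha, this.2.1⟩
      have hstep : eAux n i (m + 1) (v :: x :: u) =
          if phiOf (fAux n i m) (x :: u) < epsLetter n i v then
            (eLetter n i v).map (fun y => y :: x :: u)
          else (eAux n i m (x :: u)).map (fun u' => v :: u') := rfl
      have heR : eR n i (v :: x :: u) = if phiR n i (x :: u) < epsL n i v then
            (eLetter n i v).map (fun y => y :: x :: u)
          else (eR n i (x :: u)).map (fun u' => v :: u') := rfl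
      rw [hstep, heR, hphi, epsLetter_eq hi hin, ih _ hlen]

end Reversed

theorem phiR_append (n i : ℕ) (v u : List (BLetter n)) :
    phiR n i (v ++ u) = phiR n i v + (phiR n i u - epsR n i v) := by
  induction v with
  | nil => simp [phiR, epsR]
  | cons x v ih =>
    simp only [List.cons_append, phiR, epsR, ih]
    omega

theorem epsR_append (n i : ℕ) (v u : List (BLetter n)) :
    epsR n i (v ++ u) = epsR n i u + (epsR n i v - phiR n i u) := by
  induction v with
  | nil => simp [epsR]
  | cons x v ih =>
    simp only [List.cons_append, epsR, phiR_append, ih]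
    omega

section Append

variable {n i : ℕ} (hi : 1 ≤ i) (hin : i ≤ n)
include hi hin

theorem fR_append (v u : List (BLetter n)) :
    fR n i (v ++ u) = if phiR n i u > epsR n i v then (fR n i u).map (v ++ ·)
      else (fR n i v).map (· ++ u) := by
  induction v with
  | nil =>
    have h0 := fR_eq_none_iff hi hin u
    have h1 : epsR n i [] = 0 := rfl
    split_ifs with h
    · simp
    · exact h0.2 (by omega)
  | cons x v ih =>
    have h1 := phiR_append n i v u
    have h2 : epsR n i (x :: v) = epsR n i v + (epsL n i x - phiR n i v) := rfl
    rw [List.cons_append, fR, fR, ih]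
    split_ifs <;> (try omega) <;> simp [Option.map_map, Function.comp_def]

omit hi hin in
theorem eR_append (v u : List (BLetter n)) :
    eR n i (v ++ u) = if phiR n i u < epsR n i v then (eR n i v).map (· ++ u)
      else (eR n i u).map (v ++ ·) := by
  induction v with
  | nil => simp [epsR]
  | cons x v ih =>
    have h1 := phiR_append n i v u
    have h2 : epsR n i (x :: v) = epsR n i v + (epsL n i x - phiR n i v) := rfl
    rw [List.cons_append, eR, eR, ih]
    split_ifs <;> (try omega) <;> simp [Option.map_map, Function.comp_def]

end Append

/-! ### Words -/

/-- `ε_i` of a word by the signature rule. -/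
def eps (n i : ℕ) (w : List (BLetter n)) : ℕ := epsR n i w.reverse

/-- `φ_i` of a word by the signature rule. -/
def phi (n i : ℕ) (w : List (BLetter n)) : ℕ := phiR n i w.reverse

@[simp] theorem eps_nil (n i : ℕ) : eps n i [] = 0 := rfl

@[simp] theorem phi_nil (n i : ℕ) : phi n i [] = 0 := rfl

@[simp] theorem eps_singleton (n i : ℕ) (x : BLetter n) : eps n i [x] = epsL n i x := by
  simp [eps, phiR, epsR]

@[simp] theorem phi_singleton (n i : ℕ) (x : BLetter n) : phi n i [x] = phiL n i x := by
  simp [phi, phiR]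

theorem eps_append (n i : ℕ) (u v : List (BLetter n)) :
    eps n i (u ++ v) = eps n i u + (eps n i v - phi n i u) := by
  simp [eps, phi, epsR_append]

theorem phi_append (n i : ℕ) (u v : List (BLetter n)) :
    phi n i (u ++ v) = phi n i v + (phi n i u - eps n i v) := by
  simp [eps, phi, phiR_append]

theorem eps_cons (n i : ℕ) (x : BLetter n) (v : List (BLetter n)) :
    eps n i (x :: v) = epsL n i x + (eps n i v - phiL n i x) := by
  simpa using eps_append n i [x] v

theorem phi_cons (n i : ℕ) (x : BLetter n) (v : List (BLetter n)) :
    phi n i (x :: v) = phi n i v + (phiL n i x - eps n i v) := by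
  simpa using phi_append n i [x] v

section Words

variable {n i : ℕ} (hi : 1 ≤ i) (hin : i ≤ n)
include hi hin

theorem fWord_eq (w : List (BLetter n)) : fWord n i w = (fR n i w.reverse).map List.reverse := by
  rw [fWord, fAux_eq hi hin _ _ (by simp)]

theorem eWord_eq (w : List (BLetter n)) : eWord n i w = (eR n i w.reverse).map List.reverse := by
  rw [eWord, eAux_eq hi hin _ _ (by simp)]

theorem fWord_eq_none_iff (w : List (BLetter n)) : fWord n i w = none ↔ phi n i w = 0 := by
  rw [fWord_eq hi hin, Option.map_eq_none_iff, fR_eq_none_iff hi hin, phi]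

theorem eWord_eq_none_iff (w : List (BLetter n)) : eWord n i w = none ↔ eps n i w = 0 := by
  rw [eWord_eq hi hin, Option.map_eq_none_iff, eR_eq_none_iff hi hin, eps]

theorem fWord_spec {w w' : List (BLetter n)} (h : fWord n i w = some w') :
    w'.length = w.length ∧ phi n i w = phi n i w' + 1 ∧ eps n i w' = eps n i w + 1 := by
  rw [fWord_eq hi hin] at h
  obtain ⟨y, hy, rfl⟩ := Option.map_eq_some_iff.1 h
  simpa [phi, eps] using fR_spec hin hy

theorem eWord_eq_some_iff {w w' : List (BLetter n)} :
    eWord n i w = some w' ↔ fWord n i w' = some w := by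
  rw [fWord_eq hi hin, eWord_eq hi hin]
  constructor
  · intro h
    obtain ⟨y, hy, rfl⟩ := Option.map_eq_some_iff.1 h
    simp [(eR_eq_some_iff hin).1 hy]
  · intro h
    obtain ⟨y, hy, rfl⟩ := Option.map_eq_some_iff.1 h
    simp [(eR_eq_some_iff hin).2 hy]

theorem fWord_append (u v : List (BLetter n)) :
    fWord n i (u ++ v) = if phi n i u > eps n i v then (fWord n i u).map (· ++ v)
      else (fWord n i v).map (u ++ ·) := by
  simp only [fWord_eq hi hin, List.reverse_append, fR_append hi hin, eps, phi]
  split_ifs <;> simp [Option.map_map, Function.comp_def]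

theorem eWord_append (u v : List (BLetter n)) :
    eWord n i (u ++ v) = if phi n i u < eps n i v then (eWord n i v).map (u ++ ·)
      else (eWord n i u).map (· ++ v) := by
  simp only [eWord_eq hi hin, List.reverse_append, eR_append, eps, phi]
  split_ifs <;> simp [Option.map_map, Function.comp_def]

theorem epsW_eq (w : List (BLetter n)) : epsW n i w = eps n i w :=
  phiOf_eq (P := fun _ => True) (fun a _ => eWord_eq_none_iff hi hin a)
    (fun _ _ _ h => ⟨trivial, (fWord_spec hi hin ((eWord_eq_some_iff hi hin).1 h)).2.2⟩) w trivial

end Words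

/-! ### Counting letters in a word -/

/-- The number of letters of `c` at position `m`. -/
def cnt {n : ℕ} (m : ℕ) (c : List (BLetter n)) : ℕ :=
  c.countP (fun x : BLetter n => decide ((x : ℕ) = m))

/-- The number of letters of `c` among `1, …, j`. -/
def low {n : ℕ} (j : ℕ) (c : List (BLetter n)) : ℕ :=
  c.countP (fun x : BLetter n => decide ((x : ℕ) < j))

/-- The number of letters of `c` among `j̄, …, 1̄`. -/
def high {n : ℕ} (j : ℕ) (c : List (BLetter n)) : ℕ :=
  c.countP (fun x : BLetter n => decide (2 * n < (x : ℕ) + j))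

section Counts

variable {n : ℕ}

@[simp] theorem cnt_nil (m : ℕ) : cnt m ([] : List (BLetter n)) = 0 := rfl

theorem cnt_cons (m : ℕ) (x : BLetter n) (c : List (BLetter n)) :
    cnt m (x :: c) = cnt m c + if (x : ℕ) = m then 1 else 0 := by
  simp [cnt, List.countP_cons]

theorem low_cons (j : ℕ) (x : BLetter n) (c : List (BLetter n)) :
    low j (x :: c) = low j c + if (x : ℕ) < j then 1 else 0 := by
  simp [low, List.countP_cons]

theorem high_cons (j : ℕ) (x : BLetter n) (c : List (BLetter n)) :
    high j (x :: c) = high j c + if 2 * n < (x : ℕ) + j then 1 else 0 := by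
  simp [high, List.countP_cons]

theorem low_append (j : ℕ) (c d : List (BLetter n)) : low j (c ++ d) = low j c + low j d := by
  simp [low]

theorem high_append (j : ℕ) (c d : List (BLetter n)) : high j (c ++ d) = high j c + high j d := by
  simp [high]

@[simp] theorem low_zero (c : List (BLetter n)) : low 0 c = 0 := by
  simp [low]

theorem low_succ (j : ℕ) (c : List (BLetter n)) : low (j + 1) c = low j c + cnt j c := by
  induction c with
  | nil => rfl
  | cons x c ih =>
    simp only [low_cons, cnt_cons, ih]
    split_ifs <;> omega

theorem high_succ {j : ℕ} (hj : j ≤ 2 * n) (c : List (BLetter n)) :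
    high (j + 1) c = high j c + cnt (2 * n - j) c := by
  induction c with
  | nil => rfl
  | cons x c ih =>
    simp only [high_cons, cnt_cons, ih]
    split_ifs <;> omega

theorem length_eq_low_add_cnt_add_high (c : List (BLetter n)) :
    c.length = low n c + cnt n c + high n c := by
  induction c with
  | nil => rfl
  | cons x c ih =>
    simp only [List.length_cons, low_cons, high_cons, cnt_cons]
    split_ifs <;> omega

theorem low_mono (c : List (BLetter n)) {j k : ℕ} (h : j ≤ k) : low j c ≤ low k c :=
  List.countP_mono_left (by simp; omega)

theorem high_mono (c : List (BLetter n)) {j k : ℕ} (h : j ≤ k) : high j c ≤ high k c :=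
  List.countP_mono_left (by simp; omega)

theorem low_add_high_le_length (c : List (BLetter n)) : low n c + high n c ≤ c.length := by
  have := length_eq_low_add_cnt_add_high c
  omega

end Counts

/-! ### Columns -/

/-- The column condition: weakly increasing, only the letter `0` being repeated. -/
def Valid {n : ℕ} (c : List (BLetter n)) : Prop :=
  c.Pairwise (fun x y : BLetter n => (x : ℕ) < y ∨ (x : ℕ) = n ∧ (y : ℕ) = n)

theorem cnt_le_one {n : ℕ} {c : List (BLetter n)} (hc : Valid c) {m : ℕ} (hm : m ≠ n) :
    cnt m c ≤ 1 := by
  induction c with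
  | nil => simp
  | cons x c ih =>
    obtain ⟨h1, h2⟩ := List.pairwise_cons.1 hc
    have ih := ih h2
    rw [cnt_cons]
    split_ifs with h
    · have : cnt m c = 0 := by
        simp only [cnt, List.countP_eq_zero, decide_eq_true_eq]
        intro y hy
        have := h1 y hy
        omega
      omega
    · omega

theorem eps_phi_of_lt {n i : ℕ} (hi : 1 ≤ i) (hin : i < n) {c : List (BLetter n)} (hc : Valid c) :
    eps n i c = (cnt i c - cnt (i - 1) c) +
        (cnt (2 * n + 1 - i) c - (cnt (2 * n - i) c + (cnt (i - 1) c - cnt i c))) ∧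
    phi n i c = (cnt (2 * n - i) c + (cnt (i - 1) c - cnt i c)) - cnt (2 * n + 1 - i) c := by
  induction c with
  | nil => simp
  | cons x c ih =>
    obtain ⟨h1, h2⟩ := List.pairwise_cons.1 hc
    obtain ⟨ih1, ih2⟩ := ih h2
    have key : ∀ m, m < (x : ℕ) → cnt m c = 0 := by
      intro m hm
      simp only [cnt, List.countP_eq_zero, decide_eq_true_eq]
      intro y hy
      have := h1 y hy
      omega
    have k1 := key (i - 1)
    have k2 := key i
    have k3 := key (2 * n - i)
    rw [eps_cons, phi_cons, ih1, ih2]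
    simp only [cnt_cons, epsL, phiL, if_pos hin]
    clear ih1 ih2 key h1 h2 ih hc
    generalize cnt (i - 1) c = p at *
    generalize cnt i c = q at *
    generalize cnt (2 * n - i) c = r at *
    generalize cnt (2 * n + 1 - i) c = t at *
    rcases lt_trichotomy (x : ℕ) (i - 1) with h | h | h
    · repeat rw [if_neg (by omega)]
      omega
    · rw [if_neg (by omega), if_pos (by omega), if_neg (by omega), if_pos (by omega),
        if_neg (by omega), if_neg (by omega)]
      omega
    obtain rfl := k1 h
    by_cases h' : (x : ℕ) = i
    · rw [if_pos (by omega), if_neg (by omega), if_pos (by omega), if_neg (by omega),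
        if_neg (by omega), if_neg (by omega)]
      omega
    obtain rfl := k2 (by omega)
    split_ifs <;> omega

theorem eps_phi_self {n : ℕ} (hn : 1 ≤ n) {c : List (BLetter n)} (hc : Valid c) :
    eps n n c = max (min 1 (cnt n c)) (2 * cnt (n + 1) c) - 2 * cnt (n - 1) c ∧
    phi n n c = (min 1 (cnt n c) - cnt (n + 1) c) +
      (2 * cnt (n - 1) c - max (min 1 (cnt n c)) (2 * cnt (n + 1) c)) := by
  induction c with
  | nil => simp
  | cons x c ih =>
    obtain ⟨h1, h2⟩ := List.pairwise_cons.1 hc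
    obtain ⟨ih1, ih2⟩ := ih h2
    have key : ∀ m, m < (x : ℕ) → cnt m c = 0 := by
      intro m hm
      simp only [cnt, List.countP_eq_zero, decide_eq_true_eq]
      intro y hy
      have := h1 y hy
      omega
    have k1 := key (n - 1)
    have k2 := key n
    rw [eps_cons, phi_cons, ih1, ih2]
    simp only [cnt_cons, epsL, phiL, lt_irrefl, if_false]
    clear ih1 ih2 key h1 h2
    split_ifs <;> omega

theorem fWord_split {n i : ℕ} (hi : 1 ≤ i) (hin : i ≤ n) {c d : List (BLetter n)}
    (h : fWord n i c = some d) :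
    ∃ u x y v, c = u ++ x :: v ∧ d = u ++ y :: v ∧ fLetter n i x = some y ∧
      eps n i v < phiL n i x ∧ phi n i u ≤ epsL n i x := by
  induction c generalizing d with
  | nil => simp [(fWord_eq_none_iff hi hin []).2 rfl] at h
  | cons x c ih =>
    have h' := fWord_append hi hin [x] c
    rw [List.singleton_append, h, phi_singleton] at h'
    split_ifs at h' with h1
    · obtain ⟨y, hy, rfl⟩ := Option.map_eq_some_iff.1 h'.symm
      rw [fWord_eq hi hin, List.reverse_singleton, fR] at hy
      have hx : phiL n i x ≠ 0 := by omega
      rw [Ne, ← fLetter_eq_none_iff hi hin] at hx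
      obtain ⟨z, hz⟩ := Option.ne_none_iff_exists'.1 hx
      have h0 : phiR n i [] = 0 := rfl
      rw [if_neg (by omega), hz] at hy
      simp only [Option.map_some, List.reverse_singleton, Option.some.injEq] at hy
      subst hy
      exact ⟨[], x, z, c, rfl, rfl, hz, h1, by simp⟩
    · obtain ⟨y, hy, rfl⟩ := Option.map_eq_some_iff.1 h'.symm
      obtain ⟨u, a, b, v, rfl, rfl, hab, h2, h3⟩ := ih hy
      refine ⟨x :: u, a, b, v, rfl, rfl, hab, h2, ?_⟩
      rw [eps_append, eps_cons] at h1
      rw [phi_cons]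
      omega

theorem valid_iff_of_fWord {n i : ℕ} (hi : 1 ≤ i) (hin : i ≤ n) {c d : List (BLetter n)}
    (h : fWord n i c = some d) : Valid c ↔ Valid d := by
  obtain ⟨u, x, y, v, rfl, rfl, hxy, hv, hu⟩ := fWord_split hi hin h
  obtain ⟨hx1, hx2, hy⟩ : (x : ℕ) < 2 * n ∧ bLabel n x = i ∧ (y : ℕ) = x + 1 := by
    unfold fLetter at hxy
    split_ifs at hxy with h1
    exact ⟨h1.1, h1.2, by rw [← Option.some.inj hxy]⟩
  unfold bLabel at hx2
  simp only [Valid, List.pairwise_append, List.pairwise_cons, List.mem_cons, forall_eq_or_imp]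
  constructor
  · rintro ⟨h1, ⟨h2, h3⟩, h4⟩
    refine ⟨h1, ⟨fun b hb => ?_, h3⟩, fun a ha => ⟨?_, (h4 a ha).2⟩⟩
    · obtain ⟨b', v', rfl⟩ := List.exists_cons_of_ne_nil (List.ne_nil_of_mem hb)
      have hb' := h2 b' (by simp)
      have hbb : (b' : ℕ) ≤ b := by
        rcases List.mem_cons.1 hb with rfl | hb
        · exact le_rfl
        · have := (List.pairwise_cons.1 h3).1 b hb
          omega
      have h5 := h2 b hb
      rw [eps_cons] at hv
      clear h1 h2 h3 h4 hu h hxy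
      unfold phiL epsL at hv
      split_ifs at hv hx2 <;> omega
    · have := (h4 a ha).1
      omega
  · rintro ⟨h1, ⟨h2, h3⟩, h4⟩
    refine ⟨h1, ⟨fun b hb => ?_, h3⟩, fun a ha => ⟨?_, (h4 a ha).2⟩⟩
    · have := h2 b hb
      omega
    · have h5 := (h4 a ha).1
      rcases List.eq_nil_or_concat' u with rfl | ⟨u', a', rfl⟩
      · simp at ha
      have ha' := (h4 a' (by simp)).1
      have haa : (a : ℕ) ≤ a' := by
        rcases List.mem_append.1 ha with ha | ha
        · have := (List.pairwise_append.1 h1).2.2 a ha a' (by simp)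
          omega
        · rw [List.mem_singleton.1 ha]
      rw [phi_append, phi_singleton] at hu
      clear h1 h2 h3 h4 hv h hxy
      unfold phiL epsL at hu
      split_ifs at hu hx2 <;> omega

/-- `d` is obtained from the column `c` by replacing a letter `k + 1` by its successor. -/
structure LowStep (n k : ℕ) (c d : List (BLetter n)) : Prop where
  low_ne : ∀ j ≤ n, j ≠ k + 1 → low j d = low j c
  low_eq : low (k + 1) d + 1 = low (k + 1) c
  high_eq : ∀ j ≤ n, high j d = high j c
  mem : low (k + 1) c = low k c + 1
  of_lt : k + 1 < n → low (k + 2) c = low (k + 1) c ∧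
    2 * high (k + 1) c ≤ high (k + 2) c + high k c
  of_eq : k + 1 = n → high (k + 1) c = high k c

/-- `d` is obtained from the column `c` by replacing the predecessor of the letter
`\overline{k+1}` by this letter. -/
structure HighStep (n k : ℕ) (c d : List (BLetter n)) : Prop where
  low_eq : ∀ j ≤ n, low j d = low j c
  high_ne : ∀ j ≤ n, j ≠ k + 1 → high j d = high j c
  high_eq : high (k + 1) d = high (k + 1) c + 1
  not_mem : high (k + 1) c = high k c
  of_lt : k + 1 < n → high (k + 2) c = high (k + 1) c + 1 ∧
    2 * low (k + 1) c ≤ low (k + 2) c + low k c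
  of_eq : k + 1 = n → low (k + 1) c = low k c ∧ low n c + high n c < c.length

theorem fWord_counts {n k : ℕ} (hk : k + 1 ≤ n) {c d : List (BLetter n)} (hc : Valid c)
    (h : fWord n (k + 1) c = some d) : LowStep n k c d ∨ HighStep n k c d := by
  have hd := (valid_iff_of_fWord (by omega) hk h).1 hc
  have hspec := fWord_spec (by omega) hk h
  have hlow : ∀ j ≤ n, ∀ w : List (BLetter n), low (j + 1) w = low j w + cnt j w :=
    fun j _ w => low_succ j w
  have hhigh : ∀ j ≤ n, ∀ w : List (BLetter n), high (j + 1) w = high j w + cnt (2 * n - j) w :=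
    fun j hj w => high_succ (by omega) w
  have hlenc := length_eq_low_add_cnt_add_high c
  have hlend := length_eq_low_add_cnt_add_high d
  obtain ⟨u, x, y, v, hcu, hdu, hxy, -, -⟩ := fWord_split (by omega) hk h
  obtain ⟨hx1, hx2, hy⟩ : (x : ℕ) < 2 * n ∧ bLabel n x = k + 1 ∧ (y : ℕ) = x + 1 := by
    unfold fLetter at hxy
    split_ifs at hxy with h1
    exact ⟨h1.1, h1.2, by rw [← Option.some.inj hxy]⟩
  have hlowd : ∀ j, low j d + (if (x : ℕ) < j then 1 else 0) =
      low j c + if (y : ℕ) < j then 1 else 0 := by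
    intro j
    rw [hcu, hdu, low_append, low_append, low_cons, low_cons]
    omega
  have hhighd : ∀ j, high j d + (if 2 * n < (x : ℕ) + j then 1 else 0) =
      high j c + if 2 * n < (y : ℕ) + j then 1 else 0 := by
    intro j
    rw [hcu, hdu, high_append, high_append, high_cons, high_cons]
    omega
  unfold bLabel at hx2
  clear hcu hdu hxy h
  rcases lt_or_ge (x : ℕ) n with hxn | hxn
  · left
    rw [if_pos hxn] at hx2
    have hl1 : ∀ j ≤ n, j ≠ k + 1 → low j d = low j c := by
      intro j hj hjk
      have := hlowd j
      split_ifs at this <;> omega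
    have hl2 : low (k + 1) d + 1 = low (k + 1) c := by
      have := hlowd (k + 1)
      rwa [if_pos (by omega), if_neg (by omega)] at this
    have hh : ∀ j ≤ n, high j d = high j c := by
      intro j hj
      have := hhighd j
      rwa [if_neg (by omega), if_neg (by omega)] at this
    have hb := cnt_le_one hc (m := k) (by omega)
    have hl3 := hlow k (by omega) c
    have hl4 := hl1 k (by omega) (by omega)
    have hl5 := hlow k (by omega) d
    have hh3 := hhigh k (by omega)
    have hh4 := hh k (by omega)
    have hh5 := hh (k + 1) (by omega)
    have hh6 := hh3 c
    have hh7 := hh3 d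
    refine ⟨hl1, hl2, hh, by omega, fun hkn => ?_, fun hkn => ?_⟩
    · have hep := eps_phi_of_lt (by omega) hkn hc
      have hep' := eps_phi_of_lt (by omega) hkn hd
      rw [show k + 1 - 1 = k by omega, show 2 * n + 1 - (k + 1) = 2 * n - k by omega] at hep hep'
      have hb2 := cnt_le_one hd (m := k + 1) (by omega)
      have hl6 : low (k + 2) c = _ := hlow (k + 1) (by omega) c
      have hl7 : low (k + 2) d = _ := hlow (k + 1) (by omega) d
      have hl8 := hl1 (k + 2) (by omega) (by omega)
      have hh8 : high (k + 2) c = _ := hhigh (k + 1) (by omega) c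
      have hh9 : high (k + 2) d = _ := hhigh (k + 1) (by omega) d
      have hh10 := hh (k + 2) (by omega)
      have hb3 := cnt_le_one hc (m := 2 * n - k) (by omega)
      omega
    · subst hkn
      have hep := eps_phi_self (by omega) hc
      have hep' := eps_phi_self (by omega) hd
      rw [show k + 1 - 1 = k by omega] at hep hep'
      rw [show 2 * (k + 1) - k = k + 1 + 1 by omega] at hh3 hh6 hh7
      have hb3 := cnt_le_one hc (m := k + 1 + 1) (by omega)
      omega
  · right
    rw [if_neg (by omega)] at hx2
    have hh1 : ∀ j ≤ n, j ≠ k + 1 → high j d = high j c := by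
      intro j hj hjk
      have := hhighd j
      split_ifs at this <;> omega
    have hh2 : high (k + 1) d = high (k + 1) c + 1 := by
      have := hhighd (k + 1)
      rwa [if_neg (by omega), if_pos (by omega)] at this
    have hl : ∀ j ≤ n, low j d = low j c := by
      intro j hj
      have := hlowd j
      rwa [if_neg (by omega), if_neg (by omega)] at this
    have hb := cnt_le_one hd (m := 2 * n - k) (by omega)
    have hh3 := hhigh k (by omega) c
    have hh4 := hh1 k (by omega) (by omega)
    have hh5 := hhigh k (by omega) d
    have hl3 := hlow k (by omega) c
    have hl4 := hlow k (by omega) d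
    have hl5 := hl k (by omega)
    have hl6 := hl (k + 1) (by omega)
    refine ⟨hl, hh1, hh2, by omega, fun hkn => ?_, fun hkn => ?_⟩
    · have hep := eps_phi_of_lt (by omega) hkn hc
      have hep' := eps_phi_of_lt (by omega) hkn hd
      rw [show k + 1 - 1 = k by omega, show 2 * n + 1 - (k + 1) = 2 * n - k by omega] at hep hep'
      have hb2 := cnt_le_one hc (m := 2 * n - (k + 1)) (by omega)
      have hl7 : low (k + 2) c = _ := hlow (k + 1) (by omega) c
      have hl8 : low (k + 2) d = _ := hlow (k + 1) (by omega) d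
      have hl9 := hl (k + 2) (by omega)
      have hh6 : high (k + 2) c = _ := hhigh (k + 1) (by omega) c
      have hh7 : high (k + 2) d = _ := hhigh (k + 1) (by omega) d
      have hh8 := hh1 (k + 2) (by omega) (by omega)
      have hb3 := cnt_le_one hc (m := k) (by omega)
      omega
    · subst hkn
      have hep := eps_phi_self (by omega) hc
      have hep' := eps_phi_self (by omega) hd
      rw [show k + 1 - 1 = k by omega] at hep hep'
      rw [show 2 * (k + 1) - k = k + 1 + 1 by omega] at hb hh3 hh5
      have hb3 := cnt_le_one hc (m := k) (by omega)
      omega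

theorem low_high_bounds {n k : ℕ} (hk : k < n) {c : List (BLetter n)} (hc : Valid c) :
    low k c ≤ low (k + 1) c ∧ low (k + 1) c ≤ low k c + 1 ∧
      high k c ≤ high (k + 1) c ∧ high (k + 1) c ≤ high k c + 1 := by
  have h1 := cnt_le_one hc (m := k) (by omega)
  have h2 := cnt_le_one hc (m := 2 * n - k) (by omega)
  have h3 := low_succ k c
  have h4 := high_succ (j := k) (by omega) c
  omega

theorem eps_phi_of_low_high {n k : ℕ} (hk : k + 1 < n) {c : List (BLetter n)} (hc : Valid c) :
    eps n (k + 1) c = ((low (k + 2) c - low (k + 1) c) - (low (k + 1) c - low k c)) +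
      ((high (k + 1) c - high k c) - ((high (k + 2) c - high (k + 1) c) +
        ((low (k + 1) c - low k c) - (low (k + 2) c - low (k + 1) c)))) ∧
    phi n (k + 1) c = ((high (k + 2) c - high (k + 1) c) +
      ((low (k + 1) c - low k c) - (low (k + 2) c - low (k + 1) c))) -
        (high (k + 1) c - high k c) := by
  have h1 := low_succ k c
  have h2 : low (k + 2) c = _ := low_succ (k + 1) c
  have h3 := high_succ (j := k) (by omega) c
  have h4 : high (k + 2) c = _ := high_succ (j := k + 1) (by omega) c
  have h5 := eps_phi_of_lt (by omega) hk hc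
  rw [show k + 1 - 1 = k by omega, show 2 * n + 1 - (k + 1) = 2 * n - k by omega] at h5
  rw [h2, h4, h1, h3]
  simpa only [Nat.add_sub_cancel_left] using h5

theorem eps_phi_self_of_low_high {k : ℕ} {c : List (BLetter (k + 1))} (hc : Valid c) :
    eps (k + 1) (k + 1) c = max (min 1 (c.length - (low (k + 1) c + high (k + 1) c)))
        (2 * (high (k + 1) c - high k c)) - 2 * (low (k + 1) c - low k c) ∧
    phi (k + 1) (k + 1) c = (min 1 (c.length - (low (k + 1) c + high (k + 1) c)) -
      (high (k + 1) c - high k c)) + (2 * (low (k + 1) c - low k c) -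
        max (min 1 (c.length - (low (k + 1) c + high (k + 1) c)))
          (2 * (high (k + 1) c - high k c))) := by
  have h1 := low_succ k c
  have h3 := high_succ (j := k) (by omega) c
  have h5 := eps_phi_self (by omega) hc
  have h6 := length_eq_low_add_cnt_add_high c
  rw [show k + 1 - 1 = k by omega] at h5
  rw [show 2 * (k + 1) - k = k + 1 + 1 by omega] at h3
  rw [show cnt (k + 1) c = c.length - (low (k + 1) c + high (k + 1) c) by omega,
    show cnt (k + 1 + 1) c = high (k + 1) c - high k c by omega,
    show cnt k c = low (k + 1) c - low k c by omega] at h5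
  exact h5

/-- The columns of height at most `n` whose reading lies in `B(ω_p)`. -/
structure IsCol (n : ℕ) (c : List (BLetter n)) : Prop where
  valid : Valid c
  length_le : c.length ≤ n
  adm : ∀ m ≤ n, low m c + high m c ≤ m

theorem isCol_iff_of_fWord {n i : ℕ} (hi : 1 ≤ i) (hin : i ≤ n) {c d : List (BLetter n)}
    (h : fWord n i c = some d) : IsCol n c ↔ IsCol n d := by
  obtain ⟨k, rfl⟩ := Nat.exists_eq_succ_of_ne_zero (by omega : i ≠ 0)
  rw [Nat.succ_eq_add_one] at *
  have hv := valid_iff_of_fWord (by omega) hin h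
  have hlen := (fWord_spec (by omega) hin h).1
  by_cases hc : Valid c
  swap
  · exact ⟨fun h => absurd h.valid hc, fun h => absurd (hv.2 h.valid) hc⟩
  have hb := low_high_bounds hin hc
  have hstep := fWord_counts hin hc h
  constructor
  · intro ⟨h1, h2, h3⟩
    refine ⟨hv.1 h1, by omega, fun m hm => ?_⟩
    have h3m := h3 m hm
    rcases hstep with hs | hs
    · have h4 := hs.low_ne m hm
      have h5 := hs.low_eq
      have h6 := hs.high_eq m hm
      by_cases hmk : m = k + 1
      · subst hmk
        omega
      · have := h4 hmk
        omega
    · have h4 := hs.high_ne m hm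
      have h5 := hs.high_eq
      have h6 := hs.low_eq m hm
      by_cases hmk : m = k + 1
      · subst hmk
        have h7 := hs.not_mem
        have h8 := h3 k (by omega)
        rcases hin.lt_or_eq with hlt | rfl
        · have h9 := hs.of_lt hlt
          have h10 := h3 (k + 2) (by omega)
          omega
        · have h9 := hs.of_eq rfl
          omega
      · have := h4 hmk
        omega
  · intro ⟨h1, h2, h3⟩
    refine ⟨hc, by omega, fun m hm => ?_⟩
    have h3m := h3 m hm
    rcases hstep with hs | hs
    · have h4 := hs.low_ne m hm
      have h5 := hs.low_eq
      have h6 := hs.high_eq m hm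
      by_cases hmk : m = k + 1
      · subst hmk
        have h7 := hs.mem
        have h8 := h3 k (by omega)
        have h11 := hs.low_ne k (by omega) (by omega)
        have h12 := hs.high_eq k (by omega)
        rcases hin.lt_or_eq with hlt | rfl
        · have h9 := hs.of_lt hlt
          have h10 := h3 (k + 2) (by omega)
          have h13 := hs.low_ne (k + 2) (by omega) (by omega)
          have h14 := hs.high_eq (k + 2) (by omega)
          omega
        · have h9 := hs.of_eq rfl
          omega
      · have := h4 hmk
        omega
    · have h4 := hs.high_ne m hm
      have h5 := hs.high_eq
      have h6 := hs.low_eq m hm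
      by_cases hmk : m = k + 1
      · subst hmk
        omega
      · have := h4 hmk
        omega

/-- The compatibility condition between two adjacent columns of an orthogonal tableau, the
column `c'` being to the right of `c`. -/
structure Compat (n : ℕ) (c' c : List (BLetter n)) : Prop where
  low_high : ∀ j m, j ≤ m → m ≤ n →
    low m c' + high m c' + j ≤ low j c + high j c' + m
  low_high_length : ∀ j m, j ≤ m → m ≤ n →
    c'.length + (low m c + high m c) + j ≤ low j c + high j c' + m + c.length
  low_high_top : ∀ j ≤ n, c'.length + j ≤ low j c + high j c' + n

section Compat

variable {n k : ℕ} {c d c' d' : List (BLetter n)}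

theorem Compat.of_fWord_right (hk : k + 1 ≤ n) (hc' : Valid c') (h : Compat n c' c)
    (hf : fWord n (k + 1) c' = some d') : Compat n d' c := by
  have hlen := (fWord_spec (by omega) hk hf).1
  have hb := low_high_bounds hk hc'
  rcases fWord_counts hk hc' hf with hs | hs
  · refine ⟨fun j m hjm hm => ?_, fun j m hjm hm => ?_, fun j hj => ?_⟩
    · have h1 := h.low_high j m hjm hm
      have h2 := hs.high_eq j (by omega)
      have h3 := hs.high_eq m (by omega)
      have h4 := hs.low_ne m hm
      have h5 := hs.low_eq
      by_cases hmk : m = k + 1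
      · subst hmk
        omega
      · have := h4 hmk
        omega
    · have h1 := h.low_high_length j m hjm hm
      have h2 := hs.high_eq j (by omega)
      omega
    · have h1 := h.low_high_top j hj
      have h2 := hs.high_eq j (by omega)
      omega
  · have hle : ∀ j ≤ n, high j c' ≤ high j d' := by
      intro j hj
      by_cases hjk : j = k + 1
      · subst hjk
        have := hs.high_eq
        omega
      · exact (hs.high_ne j hj hjk).ge
    refine ⟨fun j m hjm hm => ?_, fun j m hjm hm => ?_, fun j hj => ?_⟩
    · have h1 := h.low_high j m hjm hm
      have h2 := hs.low_eq m hm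
      have h3 := hle j (by omega)
      have h4 := hs.high_eq
      have h5 := hs.not_mem
      by_cases hmk : m = k + 1
      · subst hmk
        by_cases hjk : j = k + 1
        · subst hjk
          omega
        have h6 := h.low_high j k (by omega) (by omega)
        rcases hk.lt_or_eq with hlt | rfl
        · have h7 := h.low_high j (k + 2) (by omega) (by omega)
          have h8 := hs.of_lt hlt
          omega
        · have h8 := hs.of_eq rfl
          omega
      · have := hs.high_ne m hm hmk
        omega
    · have h1 := h.low_high_length j m hjm hm
      have h2 := hle j (by omega)
      omega
    · have h1 := h.low_high_top j hj
      have h2 := hle j (by omega)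
      omega

theorem Compat.of_eWord_left (hk : k + 1 ≤ n) (hc : Valid c) (h : Compat n c' c)
    (hf : fWord n (k + 1) d = some c) : Compat n c' d := by
  have hlen := (fWord_spec (by omega) hk hf).1
  have hd := (valid_iff_of_fWord (by omega) hk hf).2 hc
  have hb := low_high_bounds hk hd
  rcases fWord_counts hk hd hf with hs | hs
  · have hle : ∀ j ≤ n, low j c ≤ low j d := by
      intro j hj
      by_cases hjk : j = k + 1
      · subst hjk
        have := hs.low_eq
        omega
      · exact (hs.low_ne j hj hjk).le
    refine ⟨fun j m hjm hm => ?_, fun j m hjm hm => ?_, fun j hj => ?_⟩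
    · have h1 := h.low_high j m hjm hm
      have h2 := hle j (by omega)
      omega
    · have h1 := h.low_high_length j m hjm hm
      have h2 := hs.high_eq m hm
      have h3 := hle j (by omega)
      have h4 := hs.low_eq
      have h5 := hs.mem
      by_cases hmk : m = k + 1
      · subst hmk
        by_cases hjk : j = k + 1
        · subst hjk
          omega
        have h6 := h.low_high_length j k (by omega) (by omega)
        have h9 := hs.low_ne k (by omega) (by omega)
        have h10 := hs.high_eq k (by omega)
        rcases hk.lt_or_eq with hlt | rfl
        · have h7 := h.low_high_length j (k + 2) (by omega) (by omega)
          have h8 := hs.of_lt hlt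
          have h11 := hs.low_ne (k + 2) (by omega) (by omega)
          have h12 := hs.high_eq (k + 2) (by omega)
          omega
        · have h8 := hs.of_eq rfl
          omega
      · have := hs.low_ne m hm hmk
        omega
    · have h1 := h.low_high_top j hj
      have h2 := hle j (by omega)
      omega
  · refine ⟨fun j m hjm hm => ?_, fun j m hjm hm => ?_, fun j hj => ?_⟩
    · have h1 := h.low_high j m hjm hm
      have h2 := hs.low_eq j (by omega)
      omega
    · have h1 := h.low_high_length j m hjm hm
      have h2 := hs.low_eq j (by omega)
      have h3 := hs.low_eq m (by omega)
      have h4 := hs.high_ne m hm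
      have h5 := hs.high_eq
      by_cases hmk : m = k + 1
      · subst hmk
        omega
      · have := h4 hmk
        omega
    · have h1 := h.low_high_top j hj
      have h2 := hs.low_eq j (by omega)
      omega

theorem Compat.of_fWord_left (hk : k + 1 ≤ n) (hc' : Valid c') (hc : Valid c) (h : Compat n c' c)
    (hf : fWord n (k + 1) c = some d) (hor : phi n (k + 1) c' = 0 ∨ 1 ≤ eps n (k + 1) c) :
    Compat n c' d := by
  have hlen := (fWord_spec (by omega) hk hf).1
  have hb := low_high_bounds hk hc
  have hb' := low_high_bounds hk hc'
  have hp := low_add_high_le_length c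
  have hp' := low_add_high_le_length c'
  rcases fWord_counts hk hc hf with hs | hs
  · have h4 := hs.low_eq
    have h5 := hs.mem
    refine ⟨fun j m hjm hm => ?_, fun j m hjm hm => ?_, fun j hj => ?_⟩
    · have h1 := h.low_high j m hjm hm
      by_cases hjk : j = k + 1
      swap
      · have := hs.low_ne j (by omega) hjk
        omega
      subst hjk
      have h2 := h.low_high k m (by omega) hm
      have h3 := h.low_high k k le_rfl (by omega)
      rcases hk.lt_or_eq with hlt | rfl
      · have h6 := hs.of_lt hlt
        have h7 := h.low_high (k + 2) (k + 2) le_rfl (by omega)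
        have h8 := eps_phi_of_low_high hlt hc
        have h9 := eps_phi_of_low_high hlt hc'
        rcases hjm.lt_or_eq with hjm | rfl
        · have h10 := h.low_high (k + 2) m (by omega) hm
          omega
        · omega
      · have h6 := hs.of_eq rfl
        have h8 := eps_phi_self_of_low_high hc
        have h9 := eps_phi_self_of_low_high hc'
        obtain rfl : m = k + 1 := by omega
        omega
    · have h1 := h.low_high_length j m hjm hm
      have h11 := hs.high_eq m hm
      have h12 : low m d ≤ low m c := by
        by_cases hmk : m = k + 1
        · subst hmk
          omega
        · exact (hs.low_ne m hm hmk).le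
      by_cases hjk : j = k + 1
      swap
      · have := hs.low_ne j (by omega) hjk
        omega
      subst hjk
      rcases hjm.eq_or_lt with rfl | hjm
      · omega
      have h2 := h.low_high_length k m (by omega) hm
      have hlt : k + 1 < n := by omega
      have h6 := hs.of_lt hlt
      have h8 := eps_phi_of_low_high hlt hc
      have h9 := eps_phi_of_low_high hlt hc'
      have h10 := h.low_high_length (k + 2) m (by omega) hm
      omega
    · have h1 := h.low_high_top j hj
      by_cases hjk : j = k + 1
      swap
      · have := hs.low_ne j (by omega) hjk
        omega
      subst hjk
      have h2 := h.low_high_top k (by omega)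
      rcases hk.lt_or_eq with hlt | rfl
      · have h6 := hs.of_lt hlt
        have h8 := eps_phi_of_low_high hlt hc
        have h9 := eps_phi_of_low_high hlt hc'
        have h10 := h.low_high_top (k + 2) (by omega)
        omega
      · have h3 := h.low_high k k le_rfl (by omega)
        have h6 := hs.of_eq rfl
        have h8 := eps_phi_self_of_low_high hc
        have h9 := eps_phi_self_of_low_high hc'
        omega
  · have h4 := hs.high_eq
    have h5 := hs.not_mem
    refine ⟨fun j m hjm hm => ?_, fun j m hjm hm => ?_, fun j hj => ?_⟩
    · have h1 := h.low_high j m hjm hm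
      have h2 := hs.low_eq j (by omega)
      omega
    · have h1 := h.low_high_length j m hjm hm
      have h2 := hs.low_eq j (by omega)
      have h3 := hs.low_eq m hm
      by_cases hmk : m = k + 1
      swap
      · have := hs.high_ne m hm hmk
        omega
      subst hmk
      rcases hk.lt_or_eq with hlt | rfl
      · have h6 := hs.of_lt hlt
        have h7 := h.low_high_length j (k + 2) (by omega) (by omega)
        rcases hjm.lt_or_eq with hjm | rfl
        · have h10 := h.low_high_length j k (by omega) (by omega)
          omega
        · have h10 := h.low_high_length k k le_rfl (by omega)
          have h11 := h.low_high_length (k + 2) (k + 2) le_rfl (by omega)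
          have h8 := eps_phi_of_low_high hlt hc
          have h9 := eps_phi_of_low_high hlt hc'
          omega
      · have h6 := hs.of_eq rfl
        rcases hjm.lt_or_eq with hjm | rfl
        · have h10 := h.low_high_length j k (by omega) (by omega)
          omega
        · have h10 := h.low_high_top (k + 1) (by omega)
          omega
    · have h1 := h.low_high_top j hj
      have h2 := hs.low_eq j (by omega)
      omega

theorem Compat.of_eWord_right (hk : k + 1 ≤ n) (hc' : Valid c') (hc : Valid c) (h : Compat n c' c)
    (hf : fWord n (k + 1) d' = some c') (hor : eps n (k + 1) c = 0 ∨ 1 ≤ phi n (k + 1) c') :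
    Compat n d' c := by
  have hlen := (fWord_spec (by omega) hk hf).1
  have hd' := (valid_iff_of_fWord (by omega) hk hf).2 hc'
  have hb := low_high_bounds hk hc
  have hb' := low_high_bounds hk hd'
  have hp := low_add_high_le_length c
  have hp' := low_add_high_le_length d'
  rcases fWord_counts hk hd' hf with hs | hs
  · have h4 := hs.low_eq
    have h5 := hs.mem
    have h12 := hs.high_eq k (by omega)
    have h13 := hs.high_eq (k + 1) hk
    have h14 := hs.low_ne k (by omega) (by omega)
    refine ⟨fun j m hjm hm => ?_, fun j m hjm hm => ?_, fun j hj => ?_⟩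
    · have h1 := h.low_high j m hjm hm
      have h2 := hs.high_eq j (by omega)
      have h3 := hs.high_eq m hm
      by_cases hmk : m = k + 1
      swap
      · have := hs.low_ne m hm hmk
        omega
      subst hmk
      rcases hk.lt_or_eq with hlt | rfl
      · have h6 := hs.of_lt hlt
        have h15 := hs.low_ne (k + 2) (by omega) (by omega)
        have h16 := hs.high_eq (k + 2) (by omega)
        have h7 := h.low_high j (k + 2) (by omega) (by omega)
        rcases hjm.lt_or_eq with hjm | rfl
        · have h10 := h.low_high j k (by omega) (by omega)
          omega
        · have h10 := h.low_high k k le_rfl (by omega)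
          have h11 := h.low_high (k + 2) (k + 2) le_rfl (by omega)
          have h8 := eps_phi_of_low_high hlt hc
          have h9 := eps_phi_of_low_high hlt hc'
          omega
      · have h6 := hs.of_eq rfl
        rcases hjm.lt_or_eq with hjm | rfl
        · have h10 := h.low_high j k (by omega) (by omega)
          omega
        · have h10 := h.low_high_top (k + 1) (by omega)
          have h11 := low_add_high_le_length c'
          have h8 := eps_phi_self_of_low_high hc
          have h9 := eps_phi_self_of_low_high hc'
          omega
    · have h1 := h.low_high_length j m hjm hm
      have h2 := hs.high_eq j (by omega)
      omega
    · have h1 := h.low_high_top j hj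
      have h2 := hs.high_eq j (by omega)
      omega
  · have h4 := hs.high_eq
    have h5 := hs.not_mem
    have h12 := hs.low_eq k (by omega)
    have h13 := hs.low_eq (k + 1) hk
    have h14 := hs.high_ne k (by omega) (by omega)
    have key : k + 1 < n → low (k + 1) c ≤ low (k + 2) c ∧
        low (k + 2) c + low k c ≤ 2 * low (k + 1) c ∧
        2 * high (k + 1) c + low (k + 2) c + low k c ≤
          high (k + 2) c + high k c + 2 * low (k + 1) c := by
      intro hlt
      have h6 := hs.of_lt hlt
      have h15 := hs.low_eq (k + 2) (by omega)
      have h16 := hs.high_ne (k + 2) (by omega) (by omega)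
      have h7 : low (k + 1) c ≤ low (k + 2) c ∧ low (k + 2) c ≤ _ ∧
          high (k + 1) c ≤ high (k + 2) c ∧
        high (k + 2) c ≤ _ := low_high_bounds hlt hc
      have h8 := (eps_phi_of_low_high hlt hc).1
      have h9 := (eps_phi_of_low_high hlt hc').2
      have h10 : phi n (k + 1) c' = 0 := by omega
      have h11 : eps n (k + 1) c = 0 := by omega
      clear h9 h10 hor h4 h5 h12 h13 h14 h6 h15 h16 hb'
      omega
    refine ⟨fun j m hjm hm => ?_, fun j m hjm hm => ?_, fun j hj => ?_⟩
    · have h1 := h.low_high j m hjm hm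
      have h11 := hs.low_eq m hm
      by_cases hjk : j = k + 1
      swap
      · have h2 := hs.high_ne j (by omega) hjk
        by_cases hmk : m = k + 1
        · subst hmk
          omega
        · have h3 := hs.high_ne m hm hmk
          omega
      subst hjk
      rcases hjm.eq_or_lt with rfl | hjm
      · omega
      have h3 := hs.high_ne m hm (by omega)
      have h2 := h.low_high k m (by omega) hm
      have hlt : k + 1 < n := by omega
      have h6 := hs.of_lt hlt
      have h15 := hs.low_eq (k + 2) (by omega)
      have h16 := hs.high_ne (k + 2) (by omega) (by omega)
      have h8 := key hlt
      have h10 := h.low_high (k + 2) m (by omega) hm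
      omega
    · have h1 := h.low_high_length j m hjm hm
      by_cases hjk : j = k + 1
      swap
      · have h2 := hs.high_ne j (by omega) hjk
        omega
      subst hjk
      have h2 := h.low_high_length k m (by omega) hm
      have h3 := h.low_high_length k k le_rfl (by omega)
      rcases hk.lt_or_eq with hlt | rfl
      · have h6 := hs.of_lt hlt
        have h15 := hs.low_eq (k + 2) (by omega)
        have h16 := hs.high_ne (k + 2) (by omega) (by omega)
        have h7 := h.low_high_length (k + 2) (k + 2) le_rfl (by omega)
        have h8 := key hlt
        rcases hjm.lt_or_eq with hjm | rfl
        · have h10 := h.low_high_length (k + 2) m (by omega) hm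
          omega
        · omega
      · have h6 := hs.of_eq rfl
        have h8 := eps_phi_self_of_low_high hc
        have h9 := eps_phi_self_of_low_high hc'
        obtain rfl : m = k + 1 := by omega
        omega
    · have h1 := h.low_high_top j hj
      by_cases hjk : j = k + 1
      swap
      · have := hs.high_ne j (by omega) hjk
        omega
      subst hjk
      have h2 := h.low_high_top k (by omega)
      rcases hk.lt_or_eq with hlt | rfl
      · have h6 := hs.of_lt hlt
        have h15 := hs.low_eq (k + 2) (by omega)
        have h16 := hs.high_ne (k + 2) (by omega) (by omega)
        have h8 := key hlt
        have h10 := h.low_high_top (k + 2) (by omega)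
        omega
      · have h3 := h.low_high_length k k le_rfl (by omega)
        have h6 := hs.of_eq rfl
        have h8 := eps_phi_self_of_low_high hc
        have h9 := eps_phi_self_of_low_high hc'
        omega

end Compat

/-! ### Sequences of columns -/

/-- A sequence of columns in reading order (from right to left in the tableau) in which
adjacent columns are compatible. -/
def Good (n : ℕ) (L : List (List (BLetter n))) : Prop :=
  (∀ c ∈ L, IsCol n c) ∧ L.IsChain (Compat n)

theorem good_singleton {n : ℕ} {c : List (BLetter n)} : Good n [c] ↔ IsCol n c := by
  simp [Good]

theorem good_cons_cons {n : ℕ} {c d : List (BLetter n)} {M : List (List (BLetter n))} :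
    Good n (c :: d :: M) ↔ IsCol n c ∧ Compat n c d ∧ Good n (d :: M) := by
  simp only [Good, List.mem_cons, forall_eq_or_imp, List.isChain_cons_cons]
  tauto

theorem exists_good_of_fWord {n k : ℕ} (hk : k + 1 ≤ n) {M : List (List (BLetter n))}
    {c w : List (BLetter n)} (hg : Good n (c :: M))
    (h : fWord n (k + 1) (c :: M).flatten = some w) :
    ∃ c' M', w = (c' :: M').flatten ∧ (c' :: M').map List.length = (c :: M).map List.length ∧
      Good n (c' :: M') ∧ (c' = c ∨
        fWord n (k + 1) c = some c' ∧ eps n (k + 1) (c :: M).flatten = eps n (k + 1) c) := by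
  have hk1 : 1 ≤ k + 1 := by omega
  induction M generalizing c w with
  | nil =>
    rw [List.flatten_cons, List.flatten_nil, List.append_nil] at h
    refine ⟨w, [], by simp, ?_, ?_, Or.inr ⟨h, by simp⟩⟩
    · simpa using (fWord_spec hk1 hk h).1
    · rw [good_singleton] at hg ⊢
      exact (isCol_iff_of_fWord hk1 hk h).1 hg
  | cons d M ih =>
    rw [good_cons_cons] at hg
    obtain ⟨hc, hcd, hg⟩ := hg
    rw [List.flatten_cons, fWord_append hk1 hk] at h
    split_ifs at h with hlt
    · obtain ⟨c', hc', rfl⟩ := Option.map_eq_some_iff.1 h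
      refine ⟨c', d :: M, by simp, ?_, ?_, Or.inr ⟨hc', ?_⟩⟩
      · simpa using (fWord_spec hk1 hk hc').1
      · exact good_cons_cons.2 ⟨(isCol_iff_of_fWord hk1 hk hc').1 hc,
          hcd.of_fWord_right hk hc.valid hc', hg⟩
      · rw [List.flatten_cons, eps_append]
        omega
    · obtain ⟨w', hw', rfl⟩ := Option.map_eq_some_iff.1 h
      obtain ⟨d', M', rfl, hlen, hg', hd⟩ := ih hg hw'
      refine ⟨c, d' :: M', by simp, ?_, good_cons_cons.2 ⟨hc, ?_, hg'⟩, Or.inl rfl⟩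
      · rw [List.map_cons, hlen]
        rfl
      · rcases hd with rfl | ⟨hd, heps⟩
        · exact hcd
        · exact hcd.of_fWord_left hk hc.valid (hg.1 d (by simp)).valid hd (by omega)

theorem exists_good_of_eWord {n k : ℕ} (hk : k + 1 ≤ n) {M : List (List (BLetter n))}
    {c w : List (BLetter n)} (hg : Good n (c :: M))
    (h : eWord n (k + 1) (c :: M).flatten = some w) :
    ∃ c' M', w = (c' :: M').flatten ∧ (c' :: M').map List.length = (c :: M).map List.length ∧
      Good n (c' :: M') ∧ (c' = c ∨ eWord n (k + 1) c = some c') := by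
  have hk1 : 1 ≤ k + 1 := by omega
  induction M generalizing c w with
  | nil =>
    rw [List.flatten_cons, List.flatten_nil, List.append_nil] at h
    refine ⟨w, [], by simp, ?_, ?_, Or.inr h⟩
    · have := (fWord_spec hk1 hk ((eWord_eq_some_iff hk1 hk).1 h)).1
      simpa using this.symm
    · rw [good_singleton] at hg ⊢
      exact (isCol_iff_of_fWord hk1 hk ((eWord_eq_some_iff hk1 hk).1 h)).2 hg
  | cons d M ih =>
    rw [good_cons_cons] at hg
    obtain ⟨hc, hcd, hg⟩ := hg
    have hd := (hg.1 d (by simp)).valid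
    rw [List.flatten_cons, eWord_append hk1 hk] at h
    split_ifs at h with hlt
    · obtain ⟨w', hw', rfl⟩ := Option.map_eq_some_iff.1 h
      obtain ⟨d', M', rfl, hlen, hg', hd'⟩ := ih hg hw'
      refine ⟨c, d' :: M', by simp, ?_, good_cons_cons.2 ⟨hc, ?_, hg'⟩, Or.inl rfl⟩
      · rw [List.map_cons, hlen]
        rfl
      · rcases hd' with rfl | hd'
        · exact hcd
        · exact hcd.of_eWord_left hk hd ((eWord_eq_some_iff hk1 hk).1 hd')
    · obtain ⟨c', hc', rfl⟩ := Option.map_eq_some_iff.1 h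
      have hf := (eWord_eq_some_iff hk1 hk).1 hc'
      refine ⟨c', d :: M, by simp, ?_, good_cons_cons.2
        ⟨(isCol_iff_of_fWord hk1 hk hf).2 hc,
          hcd.of_eWord_right hk hc.valid hd hf ?_, hg⟩, Or.inr hc'⟩
      · simpa using (fWord_spec hk1 hk hf).1.symm
      · rw [List.flatten_cons, eps_append] at hlt
        omega

/-! ### Highest weight columns -/

/-- The column `1, 2, …, p`. -/
def hwCol (n p : ℕ) : List (BLetter n) := (List.range p).map (fun r => ltr n r)

theorem length_hwCol (n p : ℕ) : (hwCol n p).length = p := by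
  simp [hwCol]

theorem val_hwCol {n p : ℕ} (hp : p ≤ n) :
    (hwCol n p).map (fun x : BLetter n => (x : ℕ)) = List.range p := by
  rw [hwCol, List.map_map]
  conv_rhs => rw [← List.map_id (List.range p)]
  refine List.map_congr_left fun r hr => ?_
  have := List.mem_range.1 hr
  simp only [Function.comp, ltr, id]
  exact Nat.mod_eq_of_lt (by omega)

theorem hwCol_succ (n p : ℕ) : hwCol n (p + 1) = hwCol n p ++ [ltr n p] := by
  simp [hwCol, List.range_succ]

theorem low_hwCol {n p : ℕ} (hp : p ≤ n) (j : ℕ) : low j (hwCol n p) = min j p := by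
  induction p with
  | zero => simp [hwCol, low]
  | succ p ih =>
    have h : (ltr n p : ℕ) = p := Nat.mod_eq_of_lt (by omega)
    rw [hwCol_succ, low_append, ih (by omega), low_cons, h]
    change _ + (0 + _) = _
    split_ifs <;> omega

theorem high_hwCol {n p j : ℕ} (hp : p ≤ n) (hj : j ≤ n) : high j (hwCol n p) = 0 := by
  induction p with
  | zero => simp [hwCol, high]
  | succ p ih =>
    have h : (ltr n p : ℕ) = p := Nat.mod_eq_of_lt (by omega)
    rw [hwCol_succ, high_append, ih (by omega), high_cons, h, if_neg (by omega)]
    rfl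

theorem isCol_hwCol {n p : ℕ} (hp : p ≤ n) : IsCol n (hwCol n p) where
  valid := by
    have h := List.pairwise_lt_range (n := p)
    rw [← val_hwCol hp, List.pairwise_map] at h
    exact h.imp fun h => Or.inl h
  length_le := by rwa [length_hwCol]
  adm m hm := by
    rw [low_hwCol hp, high_hwCol hp hm]
    omega

theorem compat_hwCol {n p p' : ℕ} (hpp : p' ≤ p) (hp : p ≤ n) :
    Compat n (hwCol n p') (hwCol n p) := by
  refine ⟨fun j m hjm hm => ?_, fun j m hjm hm => ?_, fun j hj => ?_⟩
  · rw [low_hwCol (by omega), low_hwCol hp, high_hwCol (by omega) hm,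
      high_hwCol (by omega) (by omega)]
    omega
  · rw [length_hwCol, length_hwCol, low_hwCol hp, low_hwCol hp, high_hwCol (by omega) hm,
      high_hwCol (by omega) (by omega)]
    omega
  · rw [length_hwCol, low_hwCol hp, high_hwCol (by omega) (by omega)]
    omega

theorem phi_hwCol {n p i : ℕ} (hpi : p < i) (hin : i ≤ n) : phi n i (hwCol n p) = 0 := by
  obtain ⟨k, rfl⟩ := Nat.exists_eq_succ_of_ne_zero (by omega : i ≠ 0)
  have hc := (isCol_hwCol (n := n) (p := p) (by omega)).valid
  rcases hin.lt_or_eq with hlt | rfl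
  · rw [(eps_phi_of_low_high hlt hc).2]
    repeat rw [low_hwCol (by omega)]
    repeat rw [high_hwCol (by omega) (by omega)]
    omega
  · rw [Nat.succ_eq_add_one, (eps_phi_self_of_low_high hc).2, length_hwCol]
    repeat rw [low_hwCol (by omega)]
    repeat rw [high_hwCol (by omega) (by omega)]
    omega

theorem eq_hwCol_of_low_eq {n : ℕ} {c : List (BLetter n)} (hc : IsCol n c)
    (h : low c.length c = c.length) : c = hwCol n c.length := by
  have hlt : ∀ x ∈ c, (x : ℕ) < c.length := by
    have := List.countP_eq_length.1 h
    simpa using this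
  have hsort : (c.map (fun x : BLetter n => (x : ℕ))).Pairwise (· < ·) := by
    rw [List.pairwise_map]
    refine hc.valid.imp_of_mem fun {a b} ha _ hab => ?_
    have := hlt a ha
    have := hc.length_le
    omega
  have hinj : Function.Injective (List.map (fun x : BLetter n => (x : ℕ))) :=
    List.map_injective_iff.2 Fin.val_injective
  apply hinj
  rw [val_hwCol hc.length_le]
  have hsub : (c.map (fun x : BLetter n => (x : ℕ))).Subperm (List.range c.length) := by
    refine List.Nodup.subperm (hsort.imp fun h => h.ne) fun m hm => ?_
    obtain ⟨x, hx, rfl⟩ := List.mem_map.1 hm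
    exact List.mem_range.2 (hlt x hx)
  have hperm := hsub.perm_of_length_le (by simp)
  exact hperm.eq_of_pairwise (fun a b _ _ h1 h2 => absurd h1 h2.asymm) hsort
    List.pairwise_lt_range

theorem low_length_eq_of_eps_eq_zero {n q : ℕ} {c : List (BLetter n)} (hc : IsCol n c)
    (hq : q ≤ n) (hlow : low q c = q) (heps : ∀ i, q < i → i ≤ n → eps n i c = 0) :
    low c.length c = c.length := by
  have hlen := length_eq_low_add_cnt_add_high c
  have hle := hc.length_le
  induction ht : n - q generalizing q with
  | zero =>
    obtain rfl : q = n := by omega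
    rw [show c.length = q by omega, hlow]
  | succ t ih =>
    have hb := low_high_bounds (show q < n by omega) hc.valid
    by_cases hq1 : low (q + 1) c = q + 1
    · exact ih (by omega) hq1 (fun i hi => heps i (by omega)) (by omega)
    have hlow' : ∀ s, q + s ≤ n → low (q + s) c = q := by
      intro s
      induction s with
      | zero => exact fun _ => hlow
      | succ s ihs =>
        intro hs
        rcases s with _ | s
        · simp only [Nat.zero_add]
          omega
        · have h1 := ihs (by omega)
          have h2 : low (q + s) c ≤ low (q + (s + 1)) c := low_mono c (by omega)
          have h3 : low q c ≤ low (q + s) c := low_mono c (by omega)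
          have h4 : low (q + (s + 1)) c ≤ low (q + (s + 1 + 1)) c := low_mono c (by omega)
          have h5 : eps n (q + (s + 1)) c = _ :=
            (eps_phi_of_low_high (k := q + s) (by omega) hc.valid).1
          rw [heps _ (by omega) (by omega)] at h5
          have h6 : low (q + s + 2) c = low (q + (s + 1 + 1)) c := rfl
          have h7 : low (q + s + 1) c = low (q + (s + 1)) c := rfl
          omega
    obtain ⟨m, rfl⟩ : ∃ m, n = m + 1 := ⟨n - 1, by omega⟩
    have hn := heps (m + 1) (by omega) le_rfl
    have hlown := hlow' (m + 1 - q) (by omega)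
    have hlowm := hlow' (m - q) (by omega)
    rw [show q + (m + 1 - q) = m + 1 by omega] at hlown
    rw [show q + (m - q) = m by omega] at hlowm
    rw [(eps_phi_self_of_low_high hc.valid).1] at hn
    have hhigh : ∀ s, q + s ≤ m → high (m + 1 - s) c = high (m - s) c := by
      intro s
      induction s with
      | zero =>
        intro _
        have := high_mono c (show m ≤ m + 1 by omega)
        simp only [Nat.sub_zero]
        omega
      | succ s ihs =>
        intro hs
        have h1 := ihs (by omega)
        have h2 := (eps_phi_of_low_high (k := m - s - 1) (by omega) hc.valid).1
        rw [heps _ (by omega) (by omega)] at h2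
        have h3 := hlow' (m - s - 1 - q) (by omega)
        have h4 := hlow' (m - s - q) (by omega)
        have h5 := hlow' (m + 1 - s - q) (by omega)
        rw [show q + (m - s - 1 - q) = m - s - 1 by omega] at h3
        rw [show q + (m - s - q) = m - s by omega] at h4
        rw [show q + (m + 1 - s - q) = m + 1 - s by omega] at h5
        rw [show m - s - 1 + 2 = m + 1 - s by omega, show m - s - 1 + 1 = m - s by omega,
          h3, h4, h5, h1] at h2
        have h6 := high_mono c (show m - s - 1 ≤ m - s by omega)
        rw [show m + 1 - (s + 1) = m - s by omega, show m - (s + 1) = m - s - 1 by omega]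
        omega
    have hhigh' : ∀ s, q + s ≤ m + 1 → high (q + s) c = 0 := by
      intro s
      induction s with
      | zero =>
        intro _
        have := hc.adm q hq
        simp only [Nat.add_zero]
        omega
      | succ s ihs =>
        intro hs
        have h1 := ihs (by omega)
        have h2 := hhigh (m - (q + s)) (by omega)
        rw [show m + 1 - (m - (q + s)) = q + (s + 1) by omega,
          show m - (m - (q + s)) = q + s by omega] at h2
        omega
    have h1 := hhigh' (m + 1 - q) (by omega)
    rw [show q + (m + 1 - q) = m + 1 by omega] at h1
    rw [show c.length = q by omega, hlow]

theorem eq_hwCol_of_eps_eq_zero {n q : ℕ} {M : List (List (BLetter n))} (hg : Good n M)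
    (hq : q ≤ n) (hlow : ∀ c ∈ M.head?, low q c = q)
    (heps : ∀ i, q < i → i ≤ n → eps n i M.flatten = 0) :
    M = (M.map List.length).map (hwCol n) := by
  induction M generalizing q with
  | nil => rfl
  | cons c M ih =>
    have hc := hg.1 c (by simp)
    have heps' : ∀ i, q < i → i ≤ n → eps n i c = 0 ∧ eps n i M.flatten ≤ phi n i c := by
      intro i h1 h2
      have := heps i h1 h2
      rw [List.flatten_cons, eps_append] at this
      omega
    have hlen := low_length_eq_of_eps_eq_zero hc hq (hlow c (by simp))
      fun i h1 h2 => (heps' i h1 h2).1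
    have heq := eq_hwCol_of_low_eq hc hlen
    have hqc : q ≤ c.length := by
      rw [← hlow c (by simp)]
      exact List.countP_le_length
    have hM := ih (q := c.length) ⟨fun d hd => hg.1 d (by simp [hd]), hg.2.tail⟩ hc.length_le ?_ ?_
    · rw [List.map_cons, List.map_cons, ← hM, ← heq]
    · intro d hd
      obtain ⟨M', rfl⟩ := List.head?_eq_some_iff.1 hd
      have h1 := (good_cons_cons.1 hg).2.1.low_high c.length c.length le_rfl hc.length_le
      have h2 := (hg.1 d (by simp)).adm c.length hc.length_le
      omega
    · intro i h1 h2
      have h3 := (heps' i (by omega) h2).2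
      rw [heq, phi_hwCol h1 h2] at h3
      omega

/-! ### Orthogonal tableaux -/

/-- The sum of the positions of the letters of a word. -/
def weight {n : ℕ} (w : List (BLetter n)) : ℕ := (w.map (fun x : BLetter n => (x : ℕ))).sum

theorem weight_of_fWord {n i : ℕ} (hi : 1 ≤ i) (hin : i ≤ n) {c d : List (BLetter n)}
    (h : fWord n i c = some d) : weight d = weight c + 1 := by
  obtain ⟨u, x, y, v, rfl, rfl, hxy, -, -⟩ := fWord_split hi hin h
  have hy : (y : ℕ) = x + 1 := by
    unfold fLetter at hxy
    split_ifs at hxy with h1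
    rw [← Option.some.inj hxy]
  simp only [weight, List.map_append, List.map_cons, List.sum_append, List.sum_cons, hy]
  omega

theorem reach_of_good {n : ℕ} {L : List (List (BLetter n))} (hg : Good n L) :
    Reach n ((L.map List.length).map (hwCol n)).flatten L.flatten := by
  induction hw : weight L.flatten using Nat.strong_induction_on generalizing L with
  | _ m ih =>
    by_cases h : ∀ i, 0 < i → i ≤ n → eps n i L.flatten = 0
    · rw [← eq_hwCol_of_eps_eq_zero hg (Nat.zero_le n) (by simp) h]
      exact Reach.base
    · push Not at h
      obtain ⟨i, hi, hin, he⟩ := h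
      rw [Ne, ← eWord_eq_none_iff hi hin] at he
      obtain ⟨w, hw'⟩ := Option.ne_none_iff_exists'.1 he
      have hf := (eWord_eq_some_iff hi hin).1 hw'
      obtain ⟨k, rfl⟩ := Nat.exists_eq_succ_of_ne_zero hi.ne'
      rcases L with _ | ⟨c, M⟩
      · simp [(eWord_eq_none_iff hi hin []).2 rfl] at he
      obtain ⟨c', M', rfl, hlen, hg', -⟩ := exists_good_of_eWord hin hg hw'
      have hwt := weight_of_fWord hi hin hf
      rw [← hlen]
      exact Reach.step _ hi hin _ _ (ih _ (by omega) hg' rfl) hf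

theorem exists_good_of_reach {n : ℕ} {L : List (List (BLetter n))} (hg : Good n L)
    {w : List (BLetter n)} (h : Reach n L.flatten w) :
    ∃ L', Good n L' ∧ L'.map List.length = L.map List.length ∧ w = L'.flatten := by
  induction h with
  | base => exact ⟨L, hg, rfl, rfl⟩
  | step i hi hin w w' _ hf ih =>
    obtain ⟨L', hg', hlen, rfl⟩ := ih
    obtain ⟨k, rfl⟩ := Nat.exists_eq_succ_of_ne_zero (show i ≠ 0 by omega)
    rcases L' with _ | ⟨c, M⟩
    · simp [(fWord_eq_none_iff hi hin []).2 rfl] at hf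
    · obtain ⟨c', M', rfl, hlen', hg'', -⟩ := exists_good_of_fWord hin hg' hf
      exact ⟨_, hg'', hlen'.trans hlen, rfl⟩

theorem shapeList_pairwise (n : ℕ) (μ : ℕ → ℕ) : (shapeList n μ).Pairwise (· ≥ ·) := by
  rw [shapeList, List.pairwise_flatMap]
  refine ⟨fun j _ => by simp [List.pairwise_replicate], ?_⟩
  rw [List.pairwise_reverse]
  refine List.pairwise_lt_range.imp fun {a b} hab x hx y hy => ?_
  rw [List.eq_of_mem_replicate hx, List.eq_of_mem_replicate hy]
  omega

theorem le_of_mem_shapeList {n : ℕ} {μ : ℕ → ℕ} {p : ℕ} (h : p ∈ shapeList n μ) : p ≤ n := by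
  obtain ⟨j, hj, hp⟩ := List.mem_flatMap.1 h
  rw [List.eq_of_mem_replicate hp]
  exact List.mem_range.1 (List.mem_reverse.1 hj)

theorem good_reverse_Tlam (n : ℕ) (μ : ℕ → ℕ) : Good n (Tlam n μ).reverse := by
  have hT : Tlam n μ = (shapeList n μ).map (hwCol n) := rfl
  constructor
  · intro c hc
    rw [List.mem_reverse, hT] at hc
    obtain ⟨p, hp, rfl⟩ := List.mem_map.1 hc
    exact isCol_hwCol (le_of_mem_shapeList hp)
  · rw [hT]
    apply List.Pairwise.isChain
    rw [List.pairwise_reverse, List.pairwise_map]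
    exact (shapeList_pairwise n μ).imp_of_mem fun {a b} ha _ hab =>
      compat_hwCol hab (le_of_mem_shapeList ha)

theorem map_length_Tlam (n : ℕ) (μ : ℕ → ℕ) : (Tlam n μ).map List.length = shapeList n μ := by
  change ((shapeList n μ).map (hwCol n)).map List.length = _
  rw [List.map_map]
  conv_rhs => rw [← List.map_id (shapeList n μ)]
  exact List.map_congr_left fun p _ => length_hwCol n p

theorem isOrthTab_iff_good {n : ℕ} {μ : ℕ → ℕ} {T : List (List (BLetter n))} :
    IsOrthTab n μ T ↔ IsTabloid n μ T ∧ Good n T.reverse := by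
  refine and_congr_right fun hT => ⟨fun h => ?_, fun h => ?_⟩
  · obtain ⟨L, hg, hlen, hflat⟩ := exists_good_of_reach (good_reverse_Tlam n μ) h
    have : T.reverse = L := by
      rw [List.eq_iff_flatten_eq]
      refine ⟨hflat, ?_⟩
      rw [hlen, List.map_reverse, List.map_reverse, map_length_Tlam, hT]
    rwa [this]
  · have := reach_of_good h
    rwa [List.map_reverse, hT, List.map_reverse] at this

/-! ### Raising columns -/

section Raise

variable {n k : ℕ}

theorem oiter_eWord_induction {P : List (BLetter n) → Prop} {i m : ℕ} {c d : List (BLetter n)}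
    (hP : ∀ c d, P c → eWord n i c = some d → P d) (hc : P c)
    (h : oiter (eWord n i) m c = some d) : P d := by
  induction m generalizing c with
  | zero => exact Option.some.inj h ▸ hc
  | succ m ih =>
    obtain ⟨c₁, h1, h2⟩ := Option.bind_eq_some_iff.1 h
    exact ih (hP c c₁ hc h1) h2

theorem eps_of_oiter_eWord (hk : k + 1 ≤ n) {m : ℕ} {c d : List (BLetter n)}
    (h : oiter (eWord n (k + 1)) m c = some d) : eps n (k + 1) d + m = eps n (k + 1) c := by
  induction m generalizing c with
  | zero => rw [← Option.some.inj h, add_zero]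
  | succ m ih =>
    obtain ⟨c₁, h1, h2⟩ := Option.bind_eq_some_iff.1 h
    have h3 := ih h2
    have h4 := (fWord_spec (by omega) hk ((eWord_eq_some_iff (by omega) hk).1 h1)).2.2
    omega

theorem length_of_oiter_eWord (hk : k + 1 ≤ n) {m : ℕ} {c d : List (BLetter n)}
    (h : oiter (eWord n (k + 1)) m c = some d) : d.length = c.length :=
  oiter_eWord_induction (P := fun d => d.length = c.length) (fun a b ha hab => by
    have := (fWord_spec (by omega) hk ((eWord_eq_some_iff (by omega) hk).1 hab)).1
    omega) rfl h

theorem IsCol.of_oiter_eWord (hk : k + 1 ≤ n) {m : ℕ} {c d : List (BLetter n)} (hc : IsCol n c)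
    (h : oiter (eWord n (k + 1)) m c = some d) : IsCol n d :=
  oiter_eWord_induction (fun _ _ ha hab =>
    (isCol_iff_of_fWord (by omega) hk ((eWord_eq_some_iff (by omega) hk).1 hab)).2 ha) hc h

theorem Compat.of_oiter_eWord_left (hk : k + 1 ≤ n) {m : ℕ} {c' c d : List (BLetter n)}
    (hc : IsCol n c) (hcc : Compat n c' c) (h : oiter (eWord n (k + 1)) m c = some d) :
    Compat n c' d :=
  (oiter_eWord_induction (P := fun d => IsCol n d ∧ Compat n c' d) (fun _ _ ha hab => by
    have hab := (eWord_eq_some_iff (by omega) hk).1 hab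
    exact ⟨(isCol_iff_of_fWord (by omega) hk hab).2 ha.1, ha.2.of_eWord_left hk ha.1.valid hab⟩)
    ⟨hc, hcc⟩ h).2

theorem Compat.of_oiter_eWord_right (hk : k + 1 ≤ n) {m : ℕ} {c' c d' : List (BLetter n)}
    (hc' : IsCol n c') (hc : IsCol n c) (hcc : Compat n c' c)
    (hor : eps n (k + 1) c = 0 ∨ 1 ≤ phi n (k + 1) c')
    (h : oiter (eWord n (k + 1)) m c' = some d') : Compat n d' c :=
  (oiter_eWord_induction (P := fun d' => IsCol n d' ∧ Compat n d' c ∧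
      (eps n (k + 1) c = 0 ∨ 1 ≤ phi n (k + 1) d')) (fun _ _ ha hab => by
    have hab := (eWord_eq_some_iff (by omega) hk).1 hab
    have hphi := (fWord_spec (by omega) hk hab).2.1
    exact ⟨(isCol_iff_of_fWord (by omega) hk hab).2 ha.1,
      ha.2.1.of_eWord_right hk ha.1.valid hc.valid hab ha.2.2, by omega⟩)
    ⟨hc', hcc, hor⟩ h).2.1

end Raise

theorem cnt_filter_of_imp {n m : ℕ} {p : BLetter n → Bool}
    (h : ∀ x : BLetter n, (x : ℕ) = m → p x)
    (c : List (BLetter n)) : cnt m (c.filter p) = cnt m c := by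
  rw [cnt, List.countP_filter, cnt]
  refine List.countP_congr fun x _ => ?_
  have := h x
  simp only [Bool.and_eq_true, decide_eq_true_eq]
  tauto

theorem val_ltr {n m : ℕ} (h : m ≤ 2 * n) : (ltr n m : ℕ) = m :=
  Nat.mod_eq_of_lt (by omega)

/-- A column that is not killed by `f_i` is annihilated by `ẽ_i` or not by `f̃_i`. -/
theorem NotKills.eps_eq_zero_or {n k : ℕ} (hk : k + 1 ≤ n) {c : List (BLetter n)} (hc : Valid c)
    (h : NotKills n (k + 1) c) : eps n (k + 1) c = 0 ∨ 1 ≤ phi n (k + 1) c := by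
  rcases h with h | ⟨hlt, h⟩ | ⟨rfl, r, h⟩
  · rw [Ne, fWord_eq_none_iff (by omega) hk] at h
    omega
  · left
    rw [wSub, if_pos hlt] at h
    have key : ∀ m, (m + 1 = k + 1 ∨ m = k + 1 ∨ m = 2 * n - (k + 1) ∨ m = 2 * n + 1 - (k + 1)) →
        cnt m c = cnt m [ltr n (k + 1 - 1), ltr n (2 * n + 1 - (k + 1))] := by
      intro m hm
      rw [← h, cnt_filter_of_imp]
      rintro x rfl
      simpa using hm
    simp only [cnt_cons, cnt_nil, val_ltr (show k + 1 - 1 ≤ 2 * n by omega),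
      val_ltr (show 2 * n + 1 - (k + 1) ≤ 2 * n by omega)] at key
    rw [(eps_phi_of_lt (by omega) hlt hc).1, key _ (by omega), key _ (by omega), key _ (by omega),
      key _ (by omega)]
    split_ifs <;> omega
  · left
    rw [wSub, if_neg (lt_irrefl _)] at h
    have key : ∀ m, (m + 1 = k + 1 ∨ m = k + 1 + 1) →
        cnt m c = cnt m (ltr (k + 1) (k + 1 - 1) ::
          (List.replicate r (ltr (k + 1) (k + 1)) ++ [ltr (k + 1) (k + 1 + 1)])) := by
      intro m hm
      rw [← h, cnt_filter_of_imp]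
      rintro x rfl
      simp only [decide_eq_true_eq]
      omega
    have h1 := key k (by omega)
    have h2 := cnt_le_one hc (m := k + 1 + 1) (by omega)
    rw [cnt_cons, val_ltr (by omega), if_pos (by omega)] at h1
    rw [(eps_phi_self (by omega) hc).1, show k + 1 - 1 = k by omega]
    omega

theorem good_reverse_tabOf {n s : ℕ} {C : ℕ → List (BLetter n)} :
    Good n (tabOf n s C).reverse ↔
      (∀ j, 1 ≤ j → j ≤ s → IsCol n (C j)) ∧ ∀ j, 1 ≤ j → j < s → Compat n (C (j + 1)) (C j) := by
  rw [Good, List.isChain_reverse]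
  refine and_congr ?_ ?_
  · simp only [tabOf, List.mem_reverse, List.mem_map, List.mem_range, forall_exists_index, and_imp,
      forall_apply_eq_imp_iff₂]
    constructor
    · intro h j h1 h2
      have := h (j - 1) (by omega)
      rwa [show j - 1 + 1 = j by omega] at this
    · exact fun h j hj => h (j + 1) (by omega) (by omega)
  · rw [List.isChain_iff_getElem]
    simp only [tabOf, List.length_map, List.length_range, List.getElem_map, List.getElem_range]
    constructor
    · intro h j h1 h2
      have := h (j - 1) (by omega)
      rwa [show j - 1 + 1 = j by omega] at this
    · exact fun h j hj => h (j + 1) (by omega) (by omega)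

theorem one_le_and_le_of_eLetter_ne_none {n i : ℕ} {z : BLetter n} (h : eLetter n i z ≠ none) :
    1 ≤ i ∧ i ≤ n := by
  have := z.isLt
  unfold eLetter bLabel at h
  split_ifs at h <;> simp at h <;> omega

end BCrystal

open BCrystal

/-- Let `λ = ∑_{p=1}^{n} μ_p ω_p` and let `T = C₁⋯C_s` be an orthogonal
tableau of type `B` and shape `Y(λ)` with `T ≠ T_λ`.  Let `C_k` be the rightmost column of
`T` whose reading is not a highest weight vertex, let `z` be the leftmost movable letter
of `w(C_k)` and `i₁` the (unique) index with `ẽ_{i₁}(z) ≠ 0`.  Let `l` be as prescribed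
by the algorithm: `l = 1` if `k = 1`; `l = k` if `k > 1` and (`f_{i₁}` does not kill `C_k`
or `ẽ_{i₁}(w(C_{k−1})) = 0`); otherwise `l` is the smallest integer `l < k` such that
`f_{i₁}` kills `C_j` for `j = l+1,…,k` and `ẽ_{i₁}(w(C_j)) ≠ 0` for `j = l,…,k`.
Let `T₁ = D₁⋯D_s` be the tabloid with `D_j = C_j` for `j ∉ {l,…,k}` and
`w(D_j) = ẽ_{i₁}^{ε_{i₁}(w(C_j))}(w(C_j))` for `j = l,…,k`.  Then `T₁` is again an
orthogonal tableau of type `B` and shape `Y(λ)`. -/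
theorem step_preserves_orthogonal_tableau
    (n : ℕ) (hn : 1 ≤ n) (μ : ℕ → ℕ) (s : ℕ) (C : ℕ → List (BLetter n))
    (hT : IsOrthTab n μ (tabOf n s C))
    (hTne : tabOf n s C ≠ Tlam n μ)
    (k : ℕ) (hk1 : 1 ≤ k) (hks : k ≤ s)
    (hkNH : ∃ i, 1 ≤ i ∧ i ≤ n ∧ eWord n i (C k) ≠ none)
    (hkmax : ∀ j, k < j → j ≤ s → ∀ i, 1 ≤ i → i ≤ n → eWord n i (C j) = none)
    (z : BLetter n) (t₁ t₂ : List (BLetter n))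
    (hzdec : C k = t₁ ++ z :: t₂)
    (hzmov : Movable n (C k) z)
    (hzleft : ∀ x ∈ t₁, ¬ Movable n (C k) x)
    (i₁ : ℕ) (hi₁ : eLetter n i₁ z ≠ none)
    (l : ℕ)
    (hl : (k = 1 ∧ l = 1) ∨
          (1 < k ∧ (NotKills n i₁ (C k) ∨ eWord n i₁ (C (k - 1)) = none) ∧ l = k) ∨
          (1 < k ∧ ¬(NotKills n i₁ (C k) ∨ eWord n i₁ (C (k - 1)) = none) ∧
            1 ≤ l ∧ l < k ∧
            (∀ j, l + 1 ≤ j → j ≤ k → ¬ NotKills n i₁ (C j)) ∧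
            (∀ j, l ≤ j → j ≤ k → eWord n i₁ (C j) ≠ none) ∧
            (∀ l', 1 ≤ l' → l' < l →
              ¬ ((∀ j, l' + 1 ≤ j → j ≤ k → ¬ NotKills n i₁ (C j)) ∧
                 (∀ j, l' ≤ j → j ≤ k → eWord n i₁ (C j) ≠ none)))))
    (D : ℕ → List (BLetter n))
    (hDout : ∀ j, j < l ∨ k < j → D j = C j)
    (hDin : ∀ j, l ≤ j → j ≤ k →
      some (D j) = oiter (eWord n i₁) (epsW n i₁ (C j)) (C j)) :
    IsOrthTab n μ (tabOf n s D) := by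
  obtain ⟨hi1, hin⟩ := one_le_and_le_of_eLetter_ne_none hi₁
  obtain ⟨i, rfl⟩ : ∃ i, i₁ = i + 1 := ⟨i₁ - 1, by omega⟩
  obtain ⟨hshape, hgood⟩ := isOrthTab_iff_good.1 hT
  obtain ⟨hcol, hcompat⟩ := good_reverse_tabOf.1 hgood
  have hl1 : 1 ≤ l ∧ l ≤ k := by
    rcases hl with h | h | h <;> omega
  have hraise : ∀ j, l ≤ j → j ≤ k →
      oiter (eWord n (i + 1)) (eps n (i + 1) (C j)) (C j) = some (D j) := fun j h1 h2 => by
    rw [hDin j h1 h2, epsW_eq hi1 hin]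
  have heps : ∀ j, l ≤ j → j ≤ k → eps n (i + 1) (D j) = 0 := fun j h1 h2 => by
    have := eps_of_oiter_eWord hin (hraise j h1 h2)
    omega
  have hcolD : ∀ j, 1 ≤ j → j ≤ s → IsCol n (D j) := fun j h1 h2 => by
    by_cases h : j < l ∨ k < j
    · rw [hDout j h]
      exact hcol j h1 h2
    · exact (hcol j h1 h2).of_oiter_eWord hin (hraise j (by omega) (by omega))
  have hleft : 1 < l → eps n (i + 1) (C (l - 1)) = 0 ∨ eps n (i + 1) (C l) = 0 ∨
      1 ≤ phi n (i + 1) (C l) := by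
    intro hl2
    rw [← eWord_eq_none_iff hi1 hin]
    have hnk : NotKills n (i + 1) (C l) → eps n (i + 1) (C l) = 0 ∨ 1 ≤ phi n (i + 1) (C l) :=
      NotKills.eps_eq_zero_or hin (hcol l hl1.1 (by omega)).valid
    rcases hl with ⟨_, h⟩ | ⟨_, h | h, rfl⟩ | ⟨_, _, _, _, hkill, hne, hmin⟩
    · omega
    · exact Or.inr (hnk h)
    · exact Or.inl h
    · by_contra! hcon
      refine hmin (l - 1) (by omega) (by omega) ⟨fun j h1 h2 => ?_, fun j h1 h2 => ?_⟩
      · rcases (show l ≤ j by omega).eq_or_lt with rfl | hlt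
        · intro h
          have := hnk h
          omega
        · exact hkill j hlt h2
      · rcases h1.eq_or_lt with rfl | hlt
        · exact hcon.1
        · exact hne j (by omega) h2
  refine isOrthTab_iff_good.2 ⟨?_, good_reverse_tabOf.2 ⟨hcolD, fun j h1 h2 => ?_⟩⟩
  · rw [IsTabloid, ← hshape]
    simp only [tabOf, List.map_map]
    refine List.map_congr_left fun j _ => ?_
    by_cases h : j + 1 < l ∨ k < j + 1
    · simp [hDout _ h]
    · exact length_of_oiter_eWord hin (hraise (j + 1) (by omega) (by omega))
  · have hc := hcol j h1 h2.le
    have hc' := hcol (j + 1) (by omega) h2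
    have hcc := hcompat j h1 h2
    rcases lt_or_ge j l with hjl | hjl
    · rw [hDout j (Or.inl hjl)]
      rcases (show j + 1 ≤ l by omega).lt_or_eq with hlt | rfl
      · rwa [hDout _ (Or.inl hlt)]
      · have hr := hraise (j + 1) le_rfl hl1.2
        rcases hleft (by omega) with h | h | h
        · exact hcc.of_oiter_eWord_right hin hc' hc (Or.inl h) hr
        · rw [h] at hr
          rwa [← Option.some.inj hr]
        · exact hcc.of_oiter_eWord_right hin hc' hc (Or.inr h) hr
    rcases lt_or_ge k j with hkj | hjk
    · rwa [hDout j (Or.inr hkj), hDout (j + 1) (Or.inr (by omega))]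
    have hcD := hcc.of_oiter_eWord_left hin hc (hraise j hjl hjk)
    rcases hjk.lt_or_eq with hlt | rfl
    · exact hcD.of_oiter_eWord_right hin hc' (hcolD j h1 h2.le) (Or.inl (heps j hjl hjk))
        (hraise (j + 1) (by omega) hlt)
    · rwa [hDout (j + 1) (Or.inr (by omega))]
end
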